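/- arXiv:1804.04680 — 5 statements merged into one kernel-verified Lean document; each statement's English description precedes it below -/
import Mathlib

section
/- Let f : ℂ \ {0} → ℝ be a C^∞ function that is rotation invariant, i.e. f(e^{iθ}z) = f(z) for all θ ∈ ℝ and all z ∈ ℂ \ {0}. Then f extends to a C^∞ function on all of ℂ if and only if there exists a C^∞ function φ : ℝ → ℝ such that f(t) = φ(t²) for all real t > 0. -/
open scoped ContDiff Topology
open Filter

theorem smooth_of_seq (u : ℕ → ℝ → ℝ) (h : ∀ k s, HasDerivAt (u k) (u (k+1) s) s) :
    ContDiff ℝ (⊤ : ℕ∞) (u 0) := by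
  have key : ∀ m, iteratedDeriv m (u 0) = u m := by
    intro m
    induction m with
    | zero => simp
    | succ m ih =>
      rw [iteratedDeriv_succ, ih]
      ext s
      exact (h m s).deriv
  apply contDiff_of_differentiable_iteratedDeriv
  intro m _
  rw [key]
  exact fun s => (h m s).differentiableAt

theorem smooth_param (f : ℝ → ℝ) (hf : ContDiff ℝ (⊤ : ℕ∞) f) :
    ContDiff ℝ (⊤ : ℕ∞) (fun x => ∫ s in (0:ℝ)..1, f (s * x)) := by
  have := smooth_of_seq (fun k x => ∫ s in (0:ℝ)..1, s ^ k * iteratedDeriv k f (s * x)) ?_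
  · simpa using this
  intro k x
  have hc : ∀ k, Continuous (iteratedDeriv k f) := fun k =>
    hf.continuous_iteratedDeriv k (by exact_mod_cast le_top)
  have hd : ∀ k y, HasDerivAt (iteratedDeriv k f) (iteratedDeriv (k+1) f y) y := by
    intro k y
    rw [iteratedDeriv_succ]
    exact (hf.differentiable_iteratedDeriv k (by exact_mod_cast WithTop.coe_lt_top _) y).hasDerivAt
  obtain ⟨C, hC⟩ := (isCompact_Icc (a := -(|x|+1)) (b := |x|+1)).exists_bound_of_continuousOn
    (hc (k+1)).continuousOn
  refine (intervalIntegral.hasDerivAt_integral_of_dominated_loc_of_deriv_le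
    (F := fun x s => s ^ k * iteratedDeriv k f (s * x))
    (F' := fun x s => s ^ (k+1) * iteratedDeriv (k+1) f (s * x))
    (bound := fun _ => C) (Metric.ball_mem_nhds x one_pos) ?_ ?_ ?_ ?_ ?_ ?_).2
  · have := hc k
    exact Eventually.of_forall fun y => Continuous.aestronglyMeasurable (by fun_prop)
  · have := hc k
    exact Continuous.intervalIntegrable (by fun_prop) _ _
  · have := hc (k+1)
    exact Continuous.aestronglyMeasurable (by fun_prop)
  · refine Eventually.of_forall fun t ht y hy => ?_
    rw [Set.uIoc_of_le zero_le_one] at ht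
    have h1 : |y| ≤ |x| + 1 := by
      have : |y - x| < 1 := by simpa [Real.dist_eq] using hy
      have := abs_sub_abs_le_abs_sub y x
      linarith
    have h2 : |t * y| ≤ |x| + 1 := by
      rw [abs_mul, abs_of_pos ht.1]
      nlinarith [ht.2, ht.1, abs_nonneg y]
    rw [norm_mul]
    have h3 := hC (t*y) (Set.mem_Icc.2 (abs_le.1 h2))
    have h4 : ‖t ^ (k+1)‖ ≤ 1 := by
      rw [norm_pow, Real.norm_eq_abs, abs_of_pos ht.1]
      exact pow_le_one₀ ht.1.le ht.2
    nlinarith [norm_nonneg (iteratedDeriv (k+1) f (t*y))]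
  · exact Continuous.intervalIntegrable (by fun_prop) _ _
  · refine Eventually.of_forall fun t ht y hy => ?_
    have := ((hd k (t*y)).comp y ((hasDerivAt_id y).const_mul t)).const_mul (t^k)
    refine this.congr_deriv ?_
    simp only [mul_one]; ring

theorem even_step (h : ℝ → ℝ) (hh : ContDiff ℝ (⊤ : ℕ∞) h) (he : ∀ x, h (-x) = h x) :
    ∃ h1 : ℝ → ℝ, ContDiff ℝ (⊤ : ℕ∞) h1 ∧ (∀ x, h1 (-x) = h1 x) ∧
      ∀ t, HasDerivAt h (2 * t * h1 t) t := by
  have s1 : ContDiff ℝ (⊤ : ℕ∞) (deriv h) := (contDiff_infty_iff_deriv.1 hh).2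
  have s2 : ContDiff ℝ (⊤ : ℕ∞) (deriv (deriv h)) := (contDiff_infty_iff_deriv.1 s1).2
  have o1 : ∀ x, deriv h (-x) = - deriv h x := by
    intro x
    have := deriv_comp_neg h x
    rw [show (fun x => h (-x)) = h from funext he] at this
    linarith
  have e2 : ∀ x, deriv (deriv h) (-x) = deriv (deriv h) x := by
    intro x
    have := deriv_comp_neg (deriv h) x
    rw [show (fun x => deriv h (-x)) = fun x => - deriv h x from funext o1, deriv.fun_neg] at this
    linarith
  refine ⟨fun x => (1/2) * ∫ s in (0:ℝ)..1, deriv (deriv h) (s * x),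
    contDiff_const.mul (smooth_param _ s2), ?_, ?_⟩
  · intro x
    simp only [mul_neg, e2]
  · intro t
    have h0 : deriv h 0 = 0 := by
      have := o1 0
      simp at this
      linarith
    have : t * ∫ s in (0:ℝ)..1, deriv (deriv h) (s * t) = deriv h t := by
      rw [intervalIntegral.mul_integral_comp_mul_right]
      rw [intervalIntegral.integral_deriv_eq_sub]
      · simp [h0]
      · intro x _
        exact (contDiff_infty_iff_deriv.1 s1).1 x
      · exact s2.continuous.intervalIntegrable _ _
    rw [show 2 * t * (1 / 2 * ∫ s in (0:ℝ)..1, deriv (deriv h) (s * t)) = deriv h t by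
      rw [← this]; ring]
    exact ((contDiff_infty_iff_deriv.1 hh).1 t).hasDerivAt

theorem borel_lemma_aux (a : ℕ → ℝ) : ∃ B : ℝ → ℝ, ContDiff ℝ (⊤ : ℕ∞) B ∧
    ∀ k, iteratedDeriv k B 0 = a k := by
  let χ : ContDiffBump (0:ℝ) := ⟨1, 2, one_pos, one_lt_two⟩
  let g : ℕ → ℝ → ℝ := fun n y => y ^ n * χ y
  have gs : ∀ n, ContDiff ℝ (⊤ : ℕ∞) (g n) := fun n => (contDiff_id.pow n).mul χ.contDiff
  have gc : ∀ n, HasCompactSupport (g n) := fun n => χ.hasCompactSupport.mul_left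
  have gb : ∀ n k, ∃ C, ∀ x, ‖iteratedDeriv k (g n) x‖ ≤ C := by
    intro n k
    obtain ⟨C, hC⟩ := ((gs n).continuous_iteratedFDeriv (m := k)
      (by exact_mod_cast le_top)).bounded_above_of_compact_support ((gc n).iteratedFDeriv k)
    refine ⟨C, fun x => ?_⟩
    rw [← norm_iteratedFDeriv_eq_norm_iteratedDeriv]
    exact hC x
  choose C hC using gb
  have C0 : ∀ n k, 0 ≤ C n k := fun n k => (norm_nonneg _).trans (hC n k 0)
  have g0 : ∀ n k, iteratedDeriv k (g n) 0 = if k = n then (n.factorial : ℝ) else 0 := by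
    intro n k
    have : g n =ᶠ[𝓝 0] fun y => y ^ n := by
      filter_upwards [χ.eventuallyEq_one] with y hy
      simp [g, hy]
    rw [this.iteratedDeriv_eq]
    have := iteratedDeriv_fun_pow_zero (𝕜 := ℝ) (n := k) (m := n)
    rw [this]
    by_cases hk : k = n <;> simp [hk]
  -- scale parameters
  let b : ℕ → ℝ := fun n => a n / n.factorial
  let S : ℕ → ℝ := fun n => ∑ k ∈ Finset.range n, C n k
  let T : ℕ → ℝ := fun n => 1 + |b n| * S n * 2 ^ n
  have S0 : ∀ n, 0 ≤ S n := fun n => Finset.sum_nonneg fun k _ => C0 n k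
  have T1 : ∀ n, 1 ≤ T n := fun n => by
    have := S0 n
    have : 0 ≤ |b n| * S n * 2 ^ n := by positivity
    simp only [T]; linarith
  let F : ℕ → ℝ → ℝ := fun n x => (b n / T n ^ n) * g n (T n * x)
  have Fs : ∀ n, ContDiff ℝ (⊤ : ℕ∞) (F n) := fun n =>
    contDiff_const.mul ((gs n).comp (contDiff_const.mul contDiff_id))
  have Fd : ∀ n k x, iteratedDeriv k (F n) x =
      (b n / T n ^ n) * (T n ^ k * iteratedDeriv k (g n) (T n * x)) := by
    intro n k x
    have h1 := iteratedDeriv_const_mul_field (n := k) (x := x) (b n / T n ^ n)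
      (fun x => g n (T n * x))
    have h2 := iteratedDeriv_comp_const_mul (n := k) ((gs n).of_le (by exact_mod_cast le_top)) (T n)
    rw [h2] at h1
    exact h1
  let v : ℕ → ℕ → ℝ := fun k n => if k < n then (1/2) ^ n else |b n / T n ^ n| * (T n ^ k * C n k)
  have hv : ∀ k, Summable (v k) := by
    intro k
    refine (summable_geometric_two).congr_cofinite ?_
    rw [Nat.cofinite_eq_atTop]
    filter_upwards [eventually_gt_atTop k] with n hn
    simp [v, hn]
  have hF : ∀ k n x, ‖iteratedFDeriv ℝ k (F n) x‖ ≤ v k n := by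
    intro k n x
    have hT := T1 n
    have hTp : 0 < T n := by linarith
    have hle : ‖iteratedFDeriv ℝ k (F n) x‖ ≤ |b n / T n ^ n| * (T n ^ k * C n k) := by
      rw [norm_iteratedFDeriv_eq_norm_iteratedDeriv, Fd, norm_mul, norm_mul, Real.norm_eq_abs,
        norm_pow, Real.norm_of_nonneg hTp.le]
      gcongr
      exact hC n k _
    by_cases hk : k < n
    · simp only [v, hk, if_true]
      refine hle.trans ?_
      have hCS : C n k ≤ S n :=
        Finset.single_le_sum (f := fun k => C n k) (fun k _ => C0 n k) (Finset.mem_range.2 hk)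
      have h1 : T n ^ k * T n ≤ T n ^ n := by
        rw [← pow_succ]; exact pow_le_pow_right₀ hT hk
      rw [abs_div, abs_of_pos (pow_pos hTp n), div_mul_eq_mul_div, div_le_iff₀ (pow_pos hTp n)]
      have h2 : |b n| * S n ≤ (1/2)^n * T n := by
        have : (1/2 : ℝ)^n * 2^n = 1 := by rw [← mul_pow]; norm_num
        have h3 : (1/2 : ℝ)^n * T n = (1/2)^n + |b n| * S n * ((1/2 : ℝ)^n * 2^n) := by
          simp only [T]; ring
        rw [h3, this]
        have : (0:ℝ) ≤ (1/2)^n := by positivity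
        linarith
      calc |b n| * (T n ^ k * C n k) ≤ |b n| * (T n ^ k * S n) := by gcongr
        _ = T n ^ k * (|b n| * S n) := by ring
        _ ≤ T n ^ k * ((1/2)^n * T n) := by gcongr
        _ = (1/2)^n * (T n ^ k * T n) := by ring
        _ ≤ _ := by gcongr
    · simpa only [v, hk, if_false] using hle
  refine ⟨fun x => ∑' n, F n x, contDiff_tsum (N := ⊤) (v := v) Fs (fun k _ => hv k)
    (fun k n x _ => hF k n x), ?_⟩
  intro k
  have hsum : Summable fun n => iteratedFDeriv ℝ k (F n) 0 :=
    .of_norm_bounded (hv k) fun n => hF k n 0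
  rw [iteratedDeriv_eq_iteratedFDeriv, iteratedFDeriv_tsum_apply (N := ⊤) (v := v) Fs
    (fun k _ => hv k) (fun k n x _ => hF k n x) le_top]
  rw [ContinuousMultilinearMap.tsum_eval hsum]
  simp_rw [← iteratedDeriv_eq_iteratedFDeriv, Fd, mul_zero, g0]
  rw [tsum_eq_single k]
  · have : T k ≠ 0 := by have := T1 k; positivity
    have : (k.factorial : ℝ) ≠ 0 := by positivity
    simp [b]
    field_simp
  · intro n hn
    simp [hn.symm]

theorem whitney_even (h : ℝ → ℝ) (hh : ContDiff ℝ (⊤ : ℕ∞) h) (he : ∀ x, h (-x) = h x) :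
    ∃ φ : ℝ → ℝ, ContDiff ℝ (⊤ : ℕ∞) φ ∧ ∀ t, 0 ≤ t → h t = φ (t ^ 2) := by
  let E := {h : ℝ → ℝ // ContDiff ℝ (⊤ : ℕ∞) h ∧ ∀ x, h (-x) = h x}
  have step : ∀ e : E, ∃ e' : E, ∀ t, HasDerivAt e.1 (2 * t * e'.1 t) t := by
    rintro ⟨h, hh, he⟩
    obtain ⟨h1, a, b, c⟩ := even_step h hh he
    exact ⟨⟨h1, a, b⟩, c⟩
  choose st hst using step
  let H : ℕ → E := fun n => Nat.rec ⟨h, hh, he⟩ (fun _ e => st e) n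
  have HD : ∀ k t, HasDerivAt (H k).1 (2 * t * (H (k+1)).1 t) t := fun k => hst (H k)
  obtain ⟨B, hB, hB0⟩ := borel_lemma_aux (fun k => (H k).1 0)
  have BD : ∀ k y, HasDerivAt (iteratedDeriv k B) (iteratedDeriv (k+1) B y) y := by
    intro k y
    rw [iteratedDeriv_succ]
    exact (hB.differentiable_iteratedDeriv k (by exact_mod_cast WithTop.coe_lt_top _) y).hasDerivAt
  let u : ℕ → ℝ → ℝ := fun k s => if 0 ≤ s then (H k).1 (√s) else iteratedDeriv k B s
  have uc : ∀ k, Continuous (u k) := by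
    intro k
    refine Continuous.if_le ((H k).2.1.continuous.comp Real.continuous_sqrt)
      (hB.continuous_iteratedDeriv k (by exact_mod_cast le_top)) continuous_const continuous_id ?_
    intro x hx
    rw [← hx]
    simp [hB0]
  refine ⟨u 0, smooth_of_seq u ?_, ?_⟩
  · intro k
    refine hasDerivAt_of_hasDerivAt_of_ne' (x := 0) ?_ (uc k).continuousAt (uc (k+1)).continuousAt
    intro y hy
    rcases lt_or_gt_of_ne hy with hy | hy
    · have e : u k =ᶠ[𝓝 y] iteratedDeriv k B := by
        filter_upwards [Iio_mem_nhds hy] with z hz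
        simp [u, not_le.2 (Set.mem_Iio.1 hz)]
      have : u (k+1) y = iteratedDeriv (k+1) B y := by simp [u, not_le.2 hy]
      rw [this]
      exact (BD k y).congr_of_eventuallyEq e
    · have e : u k =ᶠ[𝓝 y] (H k).1 ∘ Real.sqrt := by
        filter_upwards [Ioi_mem_nhds hy] with z hz
        simp [u, (le_of_lt hz : (0:ℝ) ≤ z)]
      have e2 : u (k+1) y = (H (k+1)).1 (√y) := by simp [u, hy.le]
      rw [e2]
      refine HasDerivAt.congr_of_eventuallyEq ?_ e
      have := (HD k (√y)).comp y (Real.hasDerivAt_sqrt hy.ne')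
      refine this.congr_deriv ?_
      have : √y ≠ 0 := (Real.sqrt_pos.2 hy).ne'
      field_simp
  · intro t ht
    simp [u, sq_nonneg, Real.sqrt_sq ht, H]

theorem rotation_invariant_extends_smoothly_iff
    (f : ℂ → ℝ) (hf : ContDiffOn ℝ (⊤ : ℕ∞) f {0}ᶜ)
    (hinv : ∀ (θ : ℝ) (z : ℂ), z ≠ 0 →
      f (Complex.exp (θ * Complex.I) * z) = f z) :
    (∃ g : ℂ → ℝ, ContDiff ℝ (⊤ : ℕ∞) g ∧ ∀ z : ℂ, z ≠ 0 → g z = f z) ↔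
      ∃ φ : ℝ → ℝ, ContDiff ℝ (⊤ : ℕ∞) φ ∧
        ∀ t : ℝ, 0 < t → f (t : ℂ) = φ (t ^ 2) := by
  constructor
  · rintro ⟨g, hg, hgf⟩
    obtain ⟨φ, hφ, h⟩ := whitney_even (fun t => g (t : ℂ))
      (hg.comp Complex.ofRealCLM.contDiff) (by
        intro x
        rcases eq_or_ne x 0 with rfl | hx
        · simp
        have hx' : (x : ℂ) ≠ 0 := by exact_mod_cast hx
        have := hinv Real.pi x hx'
        rw [Complex.exp_pi_mul_I, neg_one_mul] at this
        simp only [Complex.ofReal_neg]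
        rw [hgf _ hx', hgf _ (neg_ne_zero.2 hx'), this])
    refine ⟨φ, hφ, fun t ht => ?_⟩
    rw [← h t ht.le, hgf]
    exact_mod_cast ht.ne'
  · rintro ⟨φ, hφ, h⟩
    refine ⟨fun z => φ (‖z‖ ^ 2), hφ.comp (contDiff_norm_sq ℝ), fun z hz => ?_⟩
    have h0 : 0 < ‖z‖ := norm_pos_iff.2 hz
    have h1 := hinv z.arg (‖z‖ : ℂ) (by exact_mod_cast h0.ne')
    rw [mul_comm, Complex.norm_mul_exp_arg_mul_I] at h1
    rw [h1, h _ h0]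
end

section
/- Let q be a nonnegative integer and let w : ℂ \ {0} → ℂ be a C^∞ function satisfying w(e^{iθ}z) = e^{iqθ}·w(z) for all θ ∈ ℝ and all z ∈ ℂ \ {0}. Then w extends to a C^∞ function on all of ℂ if and only if there exists a C^∞ function φ : ℝ → ℂ such that w(t) = t^q·φ(t²) for all real t > 0. -/
open scoped ContDiff Topology

namespace EquivExt

lemma chain (F : ℕ → ℝ → ℂ) (h : ∀ n x, HasDerivAt (F n) (F (n+1) x) x) :
    ContDiff ℝ ∞ (F 0) ∧ ∀ n, iteratedDeriv n (F 0) = F n := by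
  have hd : ∀ n, deriv (F n) = F (n+1) := fun n => funext fun x => (h n x).deriv
  constructor
  · rw [contDiff_infty]
    intro m
    suffices H : ∀ m : ℕ, ∀ n, ContDiff ℝ m (F n) from H m 0
    intro m
    induction m with
    | zero =>
      intro n
      rw [Nat.cast_zero, contDiff_zero]
      exact continuous_iff_continuousAt.2 fun x => (h n x).continuousAt
    | succ m ih =>
      intro n
      rw [Nat.cast_succ, contDiff_succ_iff_deriv]
      refine ⟨fun x => (h n x).differentiableAt, by simp, ?_⟩
      rw [hd]; exact ih _
  · intro n
    induction n with
    | zero => simp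
    | succ n ih => rw [iteratedDeriv_succ, ih, hd]

lemma iter_hasDerivAt {f : ℝ → ℂ} (hf : ContDiff ℝ ∞ f) (n : ℕ) (x : ℝ) :
    HasDerivAt (iteratedDeriv n f) (iteratedDeriv (n+1) f x) x := by
  rw [iteratedDeriv_succ]
  exact (hf.differentiable_iteratedDeriv n (by exact_mod_cast WithTop.coe_lt_top _) x).hasDerivAt

lemma hadamard {f : ℝ → ℂ} (hf : ContDiff ℝ ∞ f) (h0 : f 0 = 0) :
    ∃ g : ℝ → ℂ, ContDiff ℝ ∞ g ∧ (∀ t : ℝ, f t = t * g t) ∧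
      ∀ n, iteratedDeriv (n+1) f 0 = 0 → iteratedDeriv n g 0 = 0 := by
  have hc : ∀ n, Continuous (iteratedDeriv n f) := fun n =>
    hf.continuous_iteratedDeriv n (by exact_mod_cast le_top)
  let G : ℕ → ℝ → ℂ := fun n t => ∫ s in (0:ℝ)..1, (s:ℂ)^n * iteratedDeriv (n+1) f (t * s)
  have hG : ∀ n x, HasDerivAt (G n) (G (n+1) x) x := by
    intro n x
    obtain ⟨C, hC⟩ := (isCompact_Icc (a := -(|x|+1)) (b := |x|+1)).exists_bound_of_continuousOn
      (hc (n+2)).continuousOn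
    have hcont : ∀ m : ℕ, ∀ y : ℝ, Continuous fun s : ℝ => (s:ℂ)^m * iteratedDeriv (m+1) f (y * s) := by
      intro m y
      exact (Complex.continuous_ofReal.pow m).mul ((hc (m+1)).comp (continuous_const.mul continuous_id))
    refine (intervalIntegral.hasDerivAt_integral_of_dominated_loc_of_deriv_le
      (F := fun t s => (s:ℂ)^n * iteratedDeriv (n+1) f (t * s))
      (F' := fun t s => (s:ℂ)^(n+1) * iteratedDeriv (n+1+1) f (t * s)) (bound := fun _ => C)
      (Metric.ball_mem_nhds x one_pos) ?_ ?_ ?_ ?_ ?_ ?_).2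
    · exact Filter.Eventually.of_forall fun y => (hcont n y).aestronglyMeasurable
    · exact (hcont n x).intervalIntegrable _ _
    · exact (hcont (n+1) x).aestronglyMeasurable
    · refine Filter.Eventually.of_forall fun s hs y hy => ?_
      rw [Set.uIoc_of_le zero_le_one] at hs
      have hs1 : |s| ≤ 1 := abs_le.2 ⟨by linarith [hs.1], hs.2⟩
      have hy1 : |y| ≤ |x| + 1 := by
        rw [Metric.mem_ball, Real.dist_eq] at hy
        have := abs_sub_abs_le_abs_sub y x
        linarith
      have h1 : ‖iteratedDeriv (n+2) f (y * s)‖ ≤ C := by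
        apply hC
        rw [Set.mem_Icc, ← abs_le, abs_mul]
        nlinarith [abs_nonneg y, abs_nonneg s]
      have h2 : ‖(s:ℂ)^(n+1)‖ ≤ 1 := by
        rw [norm_pow, Complex.norm_real]
        exact pow_le_one₀ (norm_nonneg _) hs1
      rw [norm_mul]
      calc _ ≤ 1 * ‖iteratedDeriv (n+2) f (y * s)‖ := by gcongr
        _ ≤ C := by rw [one_mul]; exact h1
    · exact intervalIntegrable_const
    · refine Filter.Eventually.of_forall fun s hs y hy => ?_
      have h1 : HasDerivAt (fun y : ℝ => y * s) s y := by
        simpa using (hasDerivAt_id y).mul_const s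
      have h2 := ((iter_hasDerivAt hf (n+1) (y*s)).scomp y h1).const_mul ((s:ℂ)^n)
      have e : (s:ℂ)^(n+1) * iteratedDeriv (n+1+1) f (y * s)
          = (s:ℂ)^n * s • iteratedDeriv (n+1+1) f (y * s) := by
        rw [Complex.real_smul]; ring
      rw [e]
      exact h2
  obtain ⟨hs, hi⟩ := chain G hG
  refine ⟨G 0, hs, ?_, ?_⟩
  · intro t
    have h1 : ∀ s ∈ Set.uIcc (0:ℝ) 1, HasDerivAt (fun s : ℝ => f (t * s))
        (t * iteratedDeriv 1 f (t*s)) s := by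
      intro s _
      have h1 : HasDerivAt (fun s : ℝ => t * s) t s := by
        simpa using (hasDerivAt_id s).const_mul t
      have := (iter_hasDerivAt hf 0 (t*s)).scomp s h1
      simpa [Function.comp_def] using this
    have h2 := intervalIntegral.integral_eq_sub_of_hasDerivAt h1
      ((continuous_const.mul ((hc 1).comp (continuous_const.mul continuous_id))).intervalIntegrable _ _)
    simp only [mul_one, mul_zero, h0, sub_zero] at h2
    rw [← h2, intervalIntegral.integral_const_mul]
    simp [G]
  · intro n hn
    rw [hi n]
    simp [G, hn]

lemma hadamard_pow (q : ℕ) : ∀ {f : ℝ → ℂ}, ContDiff ℝ ∞ f → (∀ k < q, iteratedDeriv k f 0 = 0) →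
    ∃ g : ℝ → ℂ, ContDiff ℝ ∞ g ∧ (∀ t : ℝ, f t = (t:ℂ)^q * g t) := by
  induction q with
  | zero => intro f hf _; exact ⟨f, hf, by simp⟩
  | succ q ih =>
    intro f hf h
    obtain ⟨g, hg, hfg, hd⟩ := hadamard hf (by simpa using h 0 (by omega))
    obtain ⟨g', hg', hgg⟩ := ih hg (fun k hk => hd k (h _ (by omega)))
    exact ⟨g', hg', fun t => by rw [hfg, hgg]; ring⟩

def Wt (q : ℕ) (W : ℂ → ℂ) : Prop := ∀ ζ z : ℂ, ‖ζ‖ = 1 → W (ζ * z) = ζ^q * W z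

lemma wt_vanish (k : ℕ) : ∀ (q : ℕ) (W : ℂ → ℂ), ContDiff ℝ ∞ W → Wt q W → k < q →
    iteratedDeriv k (fun t : ℝ => W t) 0 = 0 := by
  induction k with
  | zero =>
    intro q W _ hW hq
    have hpi := hW (Complex.exp ((Real.pi / q : ℝ) * Complex.I)) 0 (Complex.norm_exp_ofReal_mul_I _)
    rw [← Complex.exp_nat_mul] at hpi
    have : (q:ℂ) * ((Real.pi / q : ℝ) * Complex.I) = Real.pi * Complex.I := by
      have : (q:ℂ) ≠ 0 := by exact_mod_cast hq.ne'
      push_cast; field_simp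
    rw [this, Complex.exp_pi_mul_I] at hpi
    simp only [mul_zero] at hpi
    simp only [iteratedDeriv_zero, Complex.ofReal_zero]
    linear_combination hpi / 2
  | succ k ih =>
    intro q W hWs hW hq
    have hdiff : Differentiable ℝ W := hWs.differentiable (by simp)
    have hX : ∀ v : ℂ, ContDiff ℝ ∞ (fun z => fderiv ℝ W z v) := fun v =>
      (hWs.fderiv_right (m := ∞) (by simp)).clm_apply contDiff_const
    have key : ∀ ζ z v : ℂ, ‖ζ‖ = 1 → fderiv ℝ W (ζ * z) (ζ * v) = ζ^q * fderiv ℝ W z v := by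
      intro ζ z v hζ
      have h1 : HasFDerivAt (fun z => W (ζ * z))
          ((fderiv ℝ W (ζ * z)).comp (ContinuousLinearMap.mul ℝ ℂ ζ)) z :=
        (hdiff (ζ * z)).hasFDerivAt.comp z (ContinuousLinearMap.mul ℝ ℂ ζ).hasFDerivAt
      have h2 : HasFDerivAt (fun z => ζ^q * W z) (ζ^q • fderiv ℝ W z) z :=
        (hdiff z).hasFDerivAt.const_mul (ζ^q)
      have h3 : (fun z => W (ζ * z)) = fun z => ζ^q * W z := funext fun z => hW ζ z hζ
      rw [h3] at h1
      have := congrArg (fun L : ℂ →L[ℝ] ℂ => L v) (h1.unique h2)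
      simpa using this
    have lin : ∀ (z : ℂ) (a b : ℝ), fderiv ℝ W z (a + b * Complex.I) =
        a * fderiv ℝ W z 1 + b * fderiv ℝ W z Complex.I := by
      intro z a b
      have : (a + b * Complex.I : ℂ) = a • (1:ℂ) + b • Complex.I := by simp
      rw [this, map_add, map_smul, map_smul]; simp
    have h1 : ∀ ζ z : ℂ, ‖ζ‖ = 1 → ζ.re * fderiv ℝ W (ζ*z) 1 + ζ.im * fderiv ℝ W (ζ*z) Complex.I
        = ζ^q * fderiv ℝ W z 1 := by
      intro ζ z hζ
      rw [← lin, Complex.re_add_im, ← key ζ z 1 hζ, mul_one]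
    have h2 : ∀ ζ z : ℂ, ‖ζ‖ = 1 → -ζ.im * fderiv ℝ W (ζ*z) 1 + ζ.re * fderiv ℝ W (ζ*z) Complex.I
        = ζ^q * fderiv ℝ W z Complex.I := by
      intro ζ z hζ
      rw [← Complex.ofReal_neg, ← lin, ← key ζ z Complex.I hζ]
      congr 1
      apply Complex.ext <;> simp
    have hun : ∀ ζ : ℂ, ‖ζ‖ = 1 → (ζ.re - ζ.im * Complex.I) * (ζ.re + ζ.im * Complex.I) = 1 := by
      intro ζ hζ
      have h : ζ.re * ζ.re + ζ.im * ζ.im = 1 := by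
        rw [← Complex.normSq_apply, Complex.normSq_eq_norm_sq, hζ]; norm_num
      have h' : (ζ.re * ζ.re + ζ.im * ζ.im : ℂ) = 1 := by exact_mod_cast h
      linear_combination h' - (ζ.im:ℂ)^2 * Complex.I_sq
    set A : ℂ → ℂ := fun z => (fderiv ℝ W z 1 - Complex.I * fderiv ℝ W z Complex.I) / 2 with hA
    set B : ℂ → ℂ := fun z => (fderiv ℝ W z 1 + Complex.I * fderiv ℝ W z Complex.I) / 2 with hB
    have hAs : ContDiff ℝ ∞ A := ((hX 1).sub (contDiff_const.mul (hX Complex.I))).div_const 2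
    have hBs : ContDiff ℝ ∞ B := ((hX 1).add (contDiff_const.mul (hX Complex.I))).div_const 2
    obtain ⟨p, rfl⟩ : ∃ p, q = p + 1 := ⟨q - 1, by omega⟩
    have hAw : Wt p A := by
      intro ζ z hζ
      have e1 := h1 ζ z hζ
      have e2 := h2 ζ z hζ
      have hu := hun ζ hζ
      have hw := Complex.re_add_im ζ
      rw [pow_succ] at e1 e2
      have hne : ζ ≠ 0 := by rintro rfl; simp at hζ
      apply mul_left_cancel₀ hne
      simp only [hA]
      have : (ζ.re + ζ.im * Complex.I) * ((fderiv ℝ W (ζ*z) 1 - Complex.I * fderiv ℝ W (ζ*z) Complex.I) / 2)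
        = ζ * (ζ^p * ((fderiv ℝ W z 1 - Complex.I * fderiv ℝ W z Complex.I) / 2)) := by
        linear_combination (e1 - Complex.I * e2) / 2 - fderiv ℝ W (ζ*z) Complex.I * ζ.im / 2 * Complex.I_sq
      rwa [hw] at this
    have hBw : Wt (p+2) B := by
      intro ζ z hζ
      have e1 := h1 ζ z hζ
      have e2 := h2 ζ z hζ
      have hu := hun ζ hζ
      have hw := Complex.re_add_im ζ
      have : (ζ.re - ζ.im * Complex.I) * ((fderiv ℝ W (ζ*z) 1 + Complex.I * fderiv ℝ W (ζ*z) Complex.I) / 2)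
        = ζ^(p+1) * ((fderiv ℝ W z 1 + Complex.I * fderiv ℝ W z Complex.I) / 2) := by
        linear_combination (e1 + Complex.I * e2) / 2 - fderiv ℝ W (ζ*z) Complex.I * ζ.im / 2 * Complex.I_sq
      rw [hw] at hu
      simp only [hB]
      linear_combination ζ * this - ((fderiv ℝ W (ζ*z) 1 + Complex.I * fderiv ℝ W (ζ*z) Complex.I) / 2) * hu
    have hder : deriv (fun t : ℝ => W t) = (fun t : ℝ => A t) + (fun t : ℝ => B t) := by
      funext t
      have : HasDerivAt (fun t : ℝ => W t) (fderiv ℝ W t 1) t :=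
        (hdiff t).hasFDerivAt.comp_hasDerivAt t (Complex.ofRealCLM.hasDerivAt (x := t))
      rw [this.deriv]
      simp only [hA, hB, Pi.add_apply]; ring
    have hof : ContDiff ℝ ∞ (fun t : ℝ => (t:ℂ)) := Complex.ofRealCLM.contDiff
    rw [iteratedDeriv_succ', hder, iteratedDeriv_add, ih p A hAs hAw (by omega),
      ih (p+2) B hBs hBw (by omega), add_zero]
    · exact ((hAs.comp hof).of_le (by exact_mod_cast le_top)).contDiffAt
    · exact ((hBs.comp hof).of_le (by exact_mod_cast le_top)).contDiffAt


lemma borel (a : ℕ → ℂ) : ∃ ψ : ℝ → ℂ, ContDiff ℝ ∞ ψ ∧ ∀ k, iteratedDeriv k ψ 0 = a k := by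
  let χ : ContDiffBump (0:ℝ) := ⟨1, 2, one_pos, one_lt_two⟩
  have hχ : ContDiff ℝ ∞ (χ : ℝ → ℝ) := χ.contDiff
  let v : ℕ → ℝ → ℂ := fun n x => (x^n * χ x) • (a n / (n.factorial : ℂ))
  have hv : ∀ n, ContDiff ℝ ∞ (v n) := fun n =>
    ((contDiff_id.pow n).mul hχ).smul contDiff_const
  have hvc : ∀ n, HasCompactSupport (v n) := fun n => by
    have h1 : HasCompactSupport (fun x : ℝ => x^n * χ x) := χ.hasCompactSupport.mul_left
    exact h1.smul_right
  have hb : ∀ k n, ∃ M : ℝ, 0 ≤ M ∧ ∀ x, ‖iteratedDeriv k (v n) x‖ ≤ M := by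
    intro k n
    obtain ⟨C, hC⟩ := ((hvc n).iteratedFDeriv (𝕜 := ℝ) k).exists_bound_of_continuous
      ((hv n).continuous_iteratedFDeriv (m := k) (by exact_mod_cast le_top))
    refine ⟨C, (norm_nonneg _).trans (hC 0), fun x => ?_⟩
    rw [← norm_iteratedFDeriv_eq_norm_iteratedDeriv]; exact hC x
  choose M hM0 hM using hb
  let c : ℕ → ℝ := fun n => 1 + 2^n * ∑ k ∈ Finset.range n, M k n
  have hS : ∀ n, 0 ≤ ∑ k ∈ Finset.range n, M k n := fun n => Finset.sum_nonneg fun k _ => hM0 k n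
  have hc1 : ∀ n, 1 ≤ c n := fun n => by
    have := mul_nonneg (pow_nonneg (zero_le_two (α := ℝ)) n) (hS n)
    simp only [c]; linarith
  have hc0 : ∀ n, 0 < c n := fun n => one_pos.trans_le (hc1 n)
  have hcM : ∀ k n, k < n → M k n ≤ c n * (1/2)^n := by
    intro k n hk
    have h1 : M k n ≤ ∑ k ∈ Finset.range n, M k n :=
      Finset.single_le_sum (f := fun k => M k n) (fun k _ => hM0 k n) (Finset.mem_range.2 hk)
    have h2 : (2:ℝ)^n * (1/2)^n = 1 := by rw [← mul_pow]; norm_num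
    have h3 : (0:ℝ) ≤ (1/2)^n := by positivity
    calc M k n ≤ ∑ k ∈ Finset.range n, M k n := h1
      _ = (2^n * ∑ k ∈ Finset.range n, M k n) * (1/2)^n := by linear_combination -(∑ k ∈ Finset.range n, M k n) * h2
      _ ≤ c n * (1/2)^n := by simp only [c]; gcongr; linarith
  let f : ℕ → ℝ → ℂ := fun n s => ((c n)^n)⁻¹ • v n (c n * s)
  have hf : ∀ n, ContDiff ℝ ∞ (f n) := fun n =>
    ((hv n).comp (contDiff_const.mul contDiff_id)).const_smul _
  have hfd : ∀ k n s, iteratedDeriv k (f n) s = (((c n)^n)⁻¹ * (c n)^k) • iteratedDeriv k (v n) (c n * s) := by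
    intro k n s
    have hvk : ContDiff ℝ k (v n) := (hv n).of_le (by exact_mod_cast le_top)
    have := iteratedDeriv_fun_const_smul_field (x := s) (n := k) (((c n)^n)⁻¹) (fun s => v n (c n * s))
    simp only [f]
    rw [this, iteratedDeriv_comp_const_smul hvk, smul_smul]
  let u : ℕ → ℕ → ℝ := fun k n => if k < n then (1/2)^n else ((c n)^n)⁻¹ * (c n)^k * M k n
  have hu : ∀ k, Summable (u k) := by
    intro k
    refine (summable_geometric_two).congr_cofinite ?_
    rw [Nat.cofinite_eq_atTop]
    filter_upwards [Filter.eventually_gt_atTop k] with n hn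
    simp [u, hn]
  have hbd : ∀ k n s, ‖iteratedFDeriv ℝ k (f n) s‖ ≤ u k n := by
    intro k n s
    have hcn := hc0 n
    rw [norm_iteratedFDeriv_eq_norm_iteratedDeriv, hfd, norm_smul, Real.norm_of_nonneg (by positivity)]
    have h1 : ((c n)^n)⁻¹ * (c n)^k * ‖iteratedDeriv k (v n) (c n * s)‖ ≤ ((c n)^n)⁻¹ * (c n)^k * M k n := by
      gcongr; exact hM k n _
    refine h1.trans ?_
    simp only [u]
    split_ifs with hk
    · have h2 : (c n)^(k+1) ≤ (c n)^n := pow_le_pow_right₀ (hc1 n) hk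
      have h3 : (0:ℝ) ≤ (1/2)^n := by positivity
      rw [mul_assoc, inv_mul_le_iff₀ (by positivity)]
      calc (c n)^k * M k n ≤ (c n)^k * (c n * (1/2)^n) := by gcongr; exact hcM k n hk
        _ = (c n)^(k+1) * (1/2)^n := by ring
        _ ≤ _ := by gcongr
    · exact le_rfl
  have hz : ∀ k n, iteratedDeriv k (f n) 0 = if k = n then a n else 0 := by
    intro k n
    have hev : v n =ᶠ[𝓝 0] fun x => (x^n) • (a n / (n.factorial : ℂ)) := by
      filter_upwards [χ.eventuallyEq_one] with x hx
      simp only [v, hx, Pi.one_apply, mul_one]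
    have hpw : ContDiffAt ℝ k (fun x : ℝ => x^n) 0 := (contDiff_id.pow n).contDiffAt
    rw [hfd, mul_zero, hev.iteratedDeriv_eq, iteratedDeriv_smul_const hpw, iteratedDeriv_fun_pow_zero]
    have hfac : (n.factorial : ℂ) ≠ 0 := by exact_mod_cast n.factorial_ne_zero
    split_ifs with h
    · subst h
      rw [inv_mul_cancel₀ (pow_pos (hc0 k) k).ne', one_smul, Complex.real_smul]
      push_cast; field_simp
    · simp
  refine ⟨fun s => ∑' n, f n s, contDiff_tsum (N := ⊤) hf (fun k _ => hu k) (fun k n s _ => hbd k n s), ?_⟩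
  intro k
  rw [iteratedDeriv, iteratedFDeriv_tsum (N := ⊤) hf (fun k _ => hu k) (fun k n s _ => hbd k n s) le_top]
  simp only
  rw [tsum_eq_single k]
  · have := hz k k
    rwa [if_pos rfl] at this
  · intro n hn
    rw [← norm_eq_zero, norm_iteratedFDeriv_eq_norm_iteratedDeriv, hz, if_neg hn.symm, norm_zero]

lemma even_step (g : ℝ → ℂ) (hg : ContDiff ℝ ∞ g ∧ ∀ t, g (-t) = g t) :
    ∃ h : ℝ → ℂ, (ContDiff ℝ ∞ h ∧ ∀ t, h (-t) = h t) ∧ ∀ t : ℝ, deriv g t = (2 * t) * h t := by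
  obtain ⟨hs, he⟩ := hg
  have hodd : ∀ t, deriv g (-t) = - deriv g t := by
    intro t
    have h1 := deriv_comp_neg g t
    have h2 : (fun x => g (-x)) = g := funext he
    rw [h2] at h1
    rw [h1, neg_neg]
  have h0 : deriv g 0 = 0 := by
    have := hodd 0
    rw [neg_zero] at this
    linear_combination this / 2
  have hd : ContDiff ℝ ∞ (deriv g) := by
    have h := (contDiff_infty_iff_deriv (𝕜 := ℝ)).1 hs
    exact h.2
  obtain ⟨h, hh, hgh, -⟩ := hadamard hd h0
  refine ⟨fun t => h t / 2, ⟨hh.div_const 2, fun t => ?_⟩, fun t => by rw [hgh]; ring⟩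
  rcases eq_or_ne t 0 with rfl | ht
  · simp
  · have h1 := hodd t
    rw [hgh, hgh] at h1
    have ht' : (t:ℂ) ≠ 0 := by exact_mod_cast ht
    have : h (-t) = h t := by
      apply mul_left_cancel₀ ht'
      push_cast at h1
      linear_combination -h1
    simp only [this]

lemma whitney_even (g : ℝ → ℂ) (hg : ContDiff ℝ ∞ g) (he : ∀ t, g (-t) = g t) :
    ∃ φ : ℝ → ℂ, ContDiff ℝ ∞ φ ∧ ∀ t : ℝ, 0 < t → φ (t^2) = g t := by
  choose! T hT1 hT2 using even_step
  let G : ℕ → ℝ → ℂ := fun n => T^[n] g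
  have hGs : ∀ n, G (n+1) = T (G n) := fun n => Function.iterate_succ_apply' T n g
  have hG : ∀ n, ContDiff ℝ ∞ (G n) ∧ ∀ t, G n (-t) = G n t := by
    intro n
    induction n with
    | zero => exact ⟨hg, he⟩
    | succ n ih => rw [hGs]; exact hT1 _ ih
  have hGd : ∀ n (t : ℝ), deriv (G n) t = (2 * t) * G (n+1) t := by
    intro n t; rw [hGs]; exact hT2 _ (hG n) t
  obtain ⟨ψ, hψ, hψ0⟩ := borel (fun n => G n 0)
  let F : ℕ → ℝ → ℂ := fun n s => if 0 ≤ s then G n (√s) else iteratedDeriv n ψ s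
  have hcont : ∀ n, Continuous fun s => G n (√s) := fun n =>
    (hG n).1.continuous.comp Real.continuous_sqrt
  have hpos : ∀ n (s : ℝ), 0 < s → HasDerivAt (fun s => G n (√s)) (G (n+1) (√s)) s := by
    intro n s hs
    have h1 : HasDerivAt (G n) ((2 * (√s : ℝ)) * G (n+1) (√s)) (√s) := by
      rw [← hGd]
      exact ((hG n).1.differentiable (by simp) _).hasDerivAt
    have h2 := h1.scomp s (Real.hasDerivAt_sqrt hs.ne')
    have h3 : ((√s : ℝ) : ℂ) ≠ 0 := by exact_mod_cast (Real.sqrt_pos.2 hs).ne'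
    have e : G (n+1) (√s) = (1 / (2 * √s)) • ((2 * (√s : ℝ)) * G (n+1) (√s)) := by
      rw [Complex.real_smul]; push_cast; field_simp
    rw [e]; exact h2
  have hF : ∀ n x, HasDerivAt (F n) (F (n+1) x) x := by
    intro n x
    rcases lt_trichotomy x 0 with hx | rfl | hx
    · have hev : F n =ᶠ[𝓝 x] iteratedDeriv n ψ := by
        filter_upwards [eventually_lt_nhds hx] with s hs
        simp only [F, if_neg (not_le.2 hs)]
      simp only [F, if_neg (not_le.2 hx)]
      exact (iter_hasDerivAt hψ n x).congr_of_eventuallyEq hev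
    · have hR : HasDerivWithinAt (fun s => G n (√s)) (G (n+1) 0) (Set.Ici 0) 0 := by
        apply hasDerivWithinAt_Ici_of_tendsto_deriv (s := Set.Ioi 0)
        · exact fun s hs => (hpos n s hs).differentiableAt.differentiableWithinAt
        · exact (hcont n).continuousWithinAt
        · exact self_mem_nhdsWithin
        · have h1 : Filter.Tendsto (fun s => G (n+1) (√s)) (𝓝[>] 0) (𝓝 (G (n+1) 0)) := by
            have := ((hcont (n+1)).tendsto 0)
            rw [Real.sqrt_zero] at this
            exact this.mono_left nhdsWithin_le_nhds
          refine h1.congr' ?_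
          filter_upwards [self_mem_nhdsWithin] with s hs
          exact (hpos n s hs).deriv.symm
      have hL : HasDerivWithinAt (iteratedDeriv n ψ) (G (n+1) 0) (Set.Iic 0) 0 := by
        rw [← hψ0 (n+1)]
        exact (iter_hasDerivAt hψ n 0).hasDerivWithinAt
      have hF0 : ∀ m, F m 0 = G m 0 := fun m => by simp [F]
      rw [hF0]
      have hR' : HasDerivWithinAt (F n) (G (n+1) 0) (Set.Ici 0) 0 := by
        refine hR.congr (fun s hs => ?_) (by simp [F])
        simp only [F, if_pos (Set.mem_Ici.1 hs)]
      have hL' : HasDerivWithinAt (F n) (G (n+1) 0) (Set.Iic 0) 0 := by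
        refine hL.congr (fun s hs => ?_) (by rw [hF0, hψ0])
        rcases (Set.mem_Iic.1 hs).lt_or_eq with h | rfl
        · simp only [F, if_neg (not_le.2 h)]
        · rw [hF0, hψ0]
      have := hL'.union hR'
      rwa [Set.Iic_union_Ici, hasDerivWithinAt_univ] at this
    · have hev : F n =ᶠ[𝓝 x] fun s => G n (√s) := by
        filter_upwards [eventually_gt_nhds hx] with s hs
        simp only [F, if_pos hs.le]
      simp only [F, if_pos hx.le]
      exact (hpos n x hx).congr_of_eventuallyEq hev
  refine ⟨F 0, (chain F hF).1, fun t ht => ?_⟩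
  simp only [F, if_pos (sq_nonneg t), Real.sqrt_sq ht.le]
  rfl

end EquivExt

open EquivExt
theorem equivariant_extends_smoothly_iff
    (q : ℕ) (w : ℂ → ℂ) (hw : ContDiffOn ℝ (⊤ : ℕ∞) w {0}ᶜ)
    (heq : ∀ (θ : ℝ) (z : ℂ), z ≠ 0 →
      w (Complex.exp (θ * Complex.I) * z) =
        Complex.exp (q * θ * Complex.I) * w z) :
    (∃ W : ℂ → ℂ, ContDiff ℝ (⊤ : ℕ∞) W ∧ ∀ z : ℂ, z ≠ 0 → W z = w z) ↔
      ∃ φ : ℝ → ℂ, ContDiff ℝ (⊤ : ℕ∞) φ ∧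
        ∀ t : ℝ, 0 < t → w (t : ℂ) = (t : ℂ) ^ q * φ (t ^ 2) := by
  constructor
  · rintro ⟨W, hWs, hWw⟩
    have hWt : Wt q W := by
      intro ζ z hζ
      have hd : Dense ({0}ᶜ : Set ℂ) := dense_compl_singleton 0
      have h1 : Continuous fun z => W (ζ * z) := hWs.continuous.comp (continuous_const.mul continuous_id)
      have h2 : Continuous fun z => ζ^q * W z := continuous_const.mul hWs.continuous
      refine congrFun (h1.ext_on hd h2 fun z hz => ?_) z
      have hz' : z ≠ 0 := hz
      have hζ0 : ζ ≠ 0 := by rintro rfl; simp at hζ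
      have hζe : Complex.exp (ζ.arg * Complex.I) = ζ := by
        have := Complex.norm_mul_exp_arg_mul_I ζ
        rwa [hζ, Complex.ofReal_one, one_mul] at this
      have h3 := heq ζ.arg z hz'
      rw [mul_assoc, Complex.exp_nat_mul, hζe] at h3
      simp only
      rw [hWw _ (mul_ne_zero hζ0 hz'), hWw _ hz', h3]
    have hfs : ContDiff ℝ ∞ (fun t : ℝ => W t) := hWs.comp Complex.ofRealCLM.contDiff
    obtain ⟨g, hg, hfg⟩ := hadamard_pow q hfs (fun k hk => wt_vanish k q W hWs hWt hk)
    have hev : ∀ t, g (-t) = g t := by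
      intro t
      rcases eq_or_ne t 0 with rfl | ht
      · simp
      have h1 := hWt (-1) t (by simp)
      have h2 := hfg t
      have h3 := hfg (-t)
      simp only [Complex.ofReal_neg] at h2 h3
      rw [neg_one_mul, h2, h3, neg_pow] at h1
      have ht' : (-1:ℂ)^q * (t:ℂ)^q ≠ 0 := mul_ne_zero (by simp) (pow_ne_zero _ (by exact_mod_cast ht))
      apply mul_left_cancel₀ ht'
      linear_combination h1
    obtain ⟨φ, hφ, hφg⟩ := whitney_even g hg hev
    refine ⟨φ, hφ, fun t ht => ?_⟩
    rw [hφg t ht, ← hfg t, hWw]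
    exact_mod_cast ht.ne'
  · rintro ⟨φ, hφ, h⟩
    refine ⟨fun z => z^q * φ (‖z‖^2), ?_, ?_⟩
    · exact (contDiff_id.pow q).mul (hφ.comp (contDiff_norm_sq ℝ))
    · intro z hz
      have h1 := heq z.arg ‖z‖ (by exact_mod_cast norm_ne_zero_iff.2 hz)
      have h2 := Complex.norm_mul_exp_arg_mul_I z
      rw [mul_comm] at h2
      rw [h2, h _ (norm_pos_iff.2 hz), mul_assoc, Complex.exp_nat_mul, ← mul_assoc, ← mul_pow, h2] at h1
      exact h1.symm
end

section
/- Let a, d₁, d₂ be positive integers with a dividing d₁ − d₂ and a dividing d₁ + d₂; set m = |d₁ − d₂|/a and n = (d₁ + d₂)/a. Let H : ℂ \ {0} → M₂(ℝ) be a C^∞ function satisfying H(e^{iaθ}z) = R(d₁θ)·H(z)·R(d₂θ)ᵀ for all θ ∈ ℝ and z ∈ ℂ \ {0}. Then H extends to a C^∞ function on all of ℂ if and only if there exist C^∞ functions φ₁, φ₂, φ₃, φ₄ : ℝ → ℝ such that for all real t > 0: H(t)₁₁ = t^m·φ₁(t²) + t^n·φ₃(t²), H(t)₂₂ = t^m·φ₁(t²)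 − t^n·φ₃(t²), H(t)₁₂ = t^m·φ₂(t²) + t^n·φ₄(t²), and H(t)₂₁ = −t^m·φ₂(t²) + t^n·φ₄(t²). -/
open Matrix

/-- The 2×2 rotation matrix `R(θ)`. -/
noncomputable def rotMat (θ : ℝ) : Matrix (Fin 2) (Fin 2) ℝ :=
  !![Real.cos θ, -Real.sin θ; Real.sin θ, Real.cos θ]


open scoped ContDiff Topology

lemma smx_deriv {f : ℝ → ℂ} (hf : ContDiff ℝ ∞ f) : ContDiff ℝ ∞ (deriv f) :=
  (contDiff_infty_iff_deriv.1 hf).2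

lemma smx_at {f : ℝ → ℂ} (hf : ContDiff ℝ ∞ f) (n : ℕ) (x : ℝ) : ContDiffAt ℝ n f x :=
  (contDiff_infty.1 hf n).contDiffAt

lemma smx_pow {g : ℝ → ℂ} (hg : ContDiff ℝ ∞ g) (k : ℕ) :
    ContDiff ℝ ∞ (fun t : ℝ => t ^ k • g (t ^ 2)) :=
  (contDiff_id.pow k).smul (hg.comp (contDiff_id.pow 2))

lemma deriv_pow_sq {g : ℝ → ℂ} (hg : ContDiff ℝ ∞ g) (k : ℕ) :
    deriv (fun t : ℝ => t ^ k • g (t ^ 2)) =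
      fun t => (k : ℝ) • (t ^ (k - 1) • g (t ^ 2)) + (2 : ℝ) • (t ^ (k + 1) • deriv g (t ^ 2)) := by
  funext t
  have h1 : HasDerivAt g (deriv g (t ^ 2)) (t ^ 2) :=
    ((contDiff_infty_iff_deriv.1 hg).1 _).hasDerivAt
  have h2 := (hasDerivAt_pow k t).smul (HasDerivAt.scomp (h := fun x : ℝ => x ^ 2) t h1 (hasDerivAt_pow 2 t))
  refine HasDerivAt.deriv (h2.congr_deriv ?_)
  simp only [Function.comp_apply, smul_smul]
  rw [add_comm]
  congr 2
  push_cast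
  ring

lemma iter_pow_sq (j : ℕ) : ∀ (k : ℕ) (g : ℝ → ℂ), ContDiff ℝ ∞ g →
    (∀ i, j = k + 2 * i → iteratedDeriv j (fun t : ℝ => t ^ k • g (t ^ 2)) 0 =
      ((j.factorial : ℝ) / i.factorial) • iteratedDeriv i g 0) ∧
    ((∀ i, j ≠ k + 2 * i) → iteratedDeriv j (fun t : ℝ => t ^ k • g (t ^ 2)) 0 = 0) := by
  induction j with
  | zero =>
    intro k g hg
    constructor
    · intro i hi
      obtain ⟨rfl, rfl⟩ : k = 0 ∧ i = 0 := by omega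
      simp
    · intro h
      have : k ≠ 0 := fun hk => h 0 (by omega)
      simp [this]
  | succ j ih =>
    intro k g hg
    have key : iteratedDeriv (j + 1) (fun t : ℝ => t ^ k • g (t ^ 2)) 0 =
        (k : ℝ) • iteratedDeriv j (fun t : ℝ => t ^ (k - 1) • g (t ^ 2)) 0 +
        (2 : ℝ) • iteratedDeriv j (fun t : ℝ => t ^ (k + 1) • deriv g (t ^ 2)) 0 := by
      have hA := smx_pow hg (k - 1)
      have hB := smx_pow (smx_deriv hg) (k + 1)
      rw [iteratedDeriv_succ', deriv_pow_sq hg,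
        iteratedDeriv_fun_add ((smx_at hA j 0).const_smul _) ((smx_at hB j 0).const_smul _),
        iteratedDeriv_fun_const_smul (smx_at hA j 0), iteratedDeriv_fun_const_smul (smx_at hB j 0)]
    rw [key]
    constructor
    · intro i hi
      rcases Nat.eq_zero_or_pos i with rfl | hi0
      · obtain ⟨k', rfl⟩ : ∃ k', k = k' + 1 := ⟨j, by omega⟩
        rw [(ih (k' + 1 + 1) _ (smx_deriv hg)).2 (by intro i; omega),
          (ih (k' + 1 - 1) g hg).1 0 (by omega)]
        obtain rfl : k' = j := by omega
        simp [smul_smul, Nat.factorial_succ]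
        rw [← mul_assoc]
      · obtain ⟨i', rfl⟩ : ∃ i', i = i' + 1 := ⟨i - 1, by omega⟩
        rw [(ih (k + 1) _ (smx_deriv hg)).1 i' (by omega)]
        have e : (k : ℝ) • iteratedDeriv j (fun t : ℝ => t ^ (k - 1) • g (t ^ 2)) 0 =
          (k : ℝ) • ((j.factorial : ℝ) / (i' + 1).factorial) • iteratedDeriv (i' + 1) g 0 := by
          rcases Nat.eq_zero_or_pos k with rfl | hk
          · simp
          · rw [(ih (k - 1) g hg).1 (i' + 1) (by omega)]
        rw [e, ← iteratedDeriv_succ', smul_smul, smul_smul, ← add_smul]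
        congr 1
        have : (j : ℝ) + 1 = k + 2 * (i' + 1) := by exact_mod_cast hi
        rw [Nat.factorial_succ, Nat.factorial_succ]
        have h3 : (i'.factorial : ℝ) ≠ 0 := by positivity
        push_cast
        rw [this]
        field_simp
    · intro h
      rw [(ih (k + 1) _ (smx_deriv hg)).2 (fun i hi => h (i + 1) (by omega))]
      rcases Nat.eq_zero_or_pos k with rfl | hk
      · simp
      · rw [(ih (k - 1) g hg).2 (fun i hi => h i (by omega))]
        simp

lemma iter_pow_const (b : ℂ) (j k : ℕ) :
    iteratedDeriv j (fun t : ℝ => t ^ k • b) 0 = if j = k then (j.factorial : ℝ) • b else 0 := by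
  have h := iter_pow_sq j k (fun _ => b) contDiff_const
  by_cases hj : ∃ i, j = k + 2 * i
  · obtain ⟨i, hi⟩ := hj
    rw [h.1 i hi]
    rcases Nat.eq_zero_or_pos i with rfl | hi0
    · simp [hi]
    · rw [if_neg (by omega)]
      simp [iteratedDeriv_const]
      omega
  · push Not at hj
    rw [h.2 hj, if_neg (fun e => hj 0 (by omega))]

/-- Borel's lemma. -/
lemma borel_lemma (b : ℕ → ℂ) : ∃ g : ℝ → ℂ, ContDiff ℝ ∞ g ∧
    ∀ k, iteratedDeriv k g 0 = (k.factorial : ℝ) • b k := by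
  let χ : ContDiffBump (0 : ℝ) := ⟨1, 2, by norm_num, by norm_num⟩
  have hχ : ContDiff ℝ ∞ χ := χ.contDiff
  let η : ℕ → ℝ → ℂ := fun i y => χ y • (y ^ i • b i)
  have hη : ∀ i, ContDiff ℝ ∞ (η i) := fun i =>
    hχ.smul ((contDiff_id.pow i).smul contDiff_const)
  have hηs : ∀ i, HasCompactSupport (η i) := fun i => χ.hasCompactSupport.smul_right
  have hC : ∀ i k, ∃ C : ℝ, 0 ≤ C ∧ ∀ x, ‖iteratedDeriv k (η i) x‖ ≤ C := by
    intro i k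
    obtain ⟨C, hC⟩ := ((hηs i).iteratedFDeriv (𝕜 := ℝ) k).exists_bound_of_continuous
      ((hη i).continuous_iteratedFDeriv (by exact_mod_cast le_top))
    refine ⟨C, (norm_nonneg _).trans (hC 0), fun x => ?_⟩
    rw [← norm_iteratedFDeriv_eq_norm_iteratedDeriv]
    exact hC x
  choose C hC0 hC using hC
  let M : ℕ → ℝ := fun i => ∑ k ∈ Finset.range i, C i k
  have hM0 : ∀ i, 0 ≤ M i := fun i => Finset.sum_nonneg fun k _ => hC0 i k
  let L : ℕ → ℝ := fun i => 1 + M i * 2 ^ i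
  have hL1 : ∀ i, 1 ≤ L i := fun i => by
    have := mul_nonneg (hM0 i) (pow_nonneg (zero_le_two (α := ℝ)) i)
    simp only [L]; linarith
  let u : ℕ → ℝ → ℂ := fun i x => ((L i)⁻¹ ^ i) • η i (L i * x)
  have hu : ∀ i, ContDiff ℝ ∞ (u i) := fun i =>
    ((hη i).comp (contDiff_const.mul contDiff_id)).const_smul _
  have hud : ∀ i k x, iteratedDeriv k (u i) x =
      ((L i)⁻¹ ^ i) • (L i ^ k) • iteratedDeriv k (η i) (L i * x) := by
    intro i k x
    have h1 : ContDiff ℝ ∞ (fun x => η i (L i * x)) := (hη i).comp (contDiff_const.mul contDiff_id)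
    simp only [u]
    rw [iteratedDeriv_fun_const_smul (smx_at h1 k x),
      iteratedDeriv_comp_const_smul (contDiff_infty.1 (hη i) k)]
  let v : ℕ → ℕ → ℝ := fun k i => (1 / 2) ^ i +
    if i ∈ Finset.range (k + 1) then ((L i)⁻¹ ^ i) * (L i ^ k * C i k) else 0
  have hv : ∀ k, Summable (v k) := by
    intro k
    refine (summable_geometric_of_lt_one (by norm_num) (by norm_num)).add ?_
    refine summable_of_ne_finset_zero (s := Finset.range (k + 1)) fun i hi => ?_
    rw [if_neg hi]
  have hbound : ∀ k i x, ‖iteratedFDeriv ℝ k (u i) x‖ ≤ v k i := by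
    intro k i x
    have hLp : 0 < L i := lt_of_lt_of_le one_pos (hL1 i)
    rw [norm_iteratedFDeriv_eq_norm_iteratedDeriv, hud, norm_smul, norm_smul, Real.norm_of_nonneg
      (by positivity), Real.norm_of_nonneg (by positivity)]
    have h1 : (L i)⁻¹ ^ i * (L i ^ k * ‖iteratedDeriv k (η i) (L i * x)‖) ≤
        (L i)⁻¹ ^ i * (L i ^ k * C i k) := by
      gcongr
      exact hC i k _
    refine h1.trans ?_
    simp only [v]
    split_ifs with h
    · have : (0 : ℝ) ≤ (1 / 2) ^ i := by positivity
      linarith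
    · have hki : k + 1 ≤ i := by simpa using h
      have h2 : C i k ≤ M i :=
        Finset.single_le_sum (f := fun k => C i k) (fun k _ => hC0 i k) (Finset.mem_range.2 hki)
      obtain ⟨d, rfl⟩ := Nat.exists_eq_add_of_le hki
      have h3 : (L (k + 1 + d))⁻¹ ^ (k + 1 + d) * (L (k + 1 + d) ^ k * C (k + 1 + d) k) =
          (L (k + 1 + d))⁻¹ ^ d * ((L (k + 1 + d))⁻¹ * C (k + 1 + d) k) := by
        have h6 : (L (k + 1 + d))⁻¹ ^ k * L (k + 1 + d) ^ k = 1 := by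
          rw [← mul_pow, inv_mul_cancel₀ hLp.ne', one_pow]
        rw [pow_add, pow_succ]
        linear_combination ((L (k + 1 + d))⁻¹ ^ d * ((L (k + 1 + d))⁻¹ * C (k + 1 + d) k)) * h6
      rw [h3, add_zero]
      have h4 : (L (k + 1 + d))⁻¹ ^ d ≤ 1 := pow_le_one₀ (by positivity) (inv_le_one_of_one_le₀ (hL1 _))
      have h5 : (L (k + 1 + d))⁻¹ * C (k + 1 + d) k ≤ (1 / 2) ^ (k + 1 + d) := by
        rw [inv_mul_le_iff₀ hLp, one_div, inv_pow, ← div_eq_mul_inv, le_div_iff₀ (by positivity)]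
        have := mul_le_mul_of_nonneg_right h2 (pow_nonneg (zero_le_two (α := ℝ)) (k + 1 + d))
        simp only [L] at *
        linarith
      calc _ ≤ 1 * ((L (k + 1 + d))⁻¹ * C (k + 1 + d) k) := by
            gcongr
            have := hC0 (k + 1 + d) k
            positivity
        _ ≤ _ := by rwa [one_mul]
  have hu0 : ∀ i k, iteratedDeriv k (u i) 0 = if k = i then (k.factorial : ℝ) • b k else 0 := by
    intro i k
    have he : η i =ᶠ[𝓝 0] fun y : ℝ => y ^ i • b i := by
      filter_upwards [χ.eventuallyEq_one] with y hy
      simp [η, hy]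
    rw [hud, mul_zero, (he.iteratedDeriv k).eq_of_nhds, iter_pow_const]
    split_ifs with h
    · subst h
      rw [smul_smul, inv_pow, inv_mul_cancel₀, one_smul]
      exact pow_ne_zero _ (lt_of_lt_of_le one_pos (hL1 k)).ne'
    · simp
  refine ⟨fun x => ∑' i, u i x, ?_, fun k => ?_⟩
  · exact contDiff_tsum (N := ⊤) hu (fun k _ => hv k) (fun k i x _ => hbound k i x)
  · rw [iteratedDeriv_eq_iteratedFDeriv, iteratedFDeriv_tsum_apply (N := ⊤) hu (fun k _ => hv k)
      (fun k i x _ => hbound k i x) le_top, tsum_eq_single k, ← iteratedDeriv_eq_iteratedFDeriv,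
      hu0, if_pos rfl]
    intro i hi
    rw [← norm_eq_zero, norm_iteratedFDeriv_eq_norm_iteratedDeriv, hu0, if_neg hi.symm, norm_zero]

/-- smooth and flat at `0` -/
def IsFlat (r : ℝ → ℂ) : Prop := ContDiff ℝ ∞ r ∧ ∀ n, iteratedDeriv n r 0 = 0

lemma IsFlat.deriv {r : ℝ → ℂ} (h : IsFlat r) : IsFlat (deriv r) :=
  ⟨smx_deriv h.1, fun n => by rw [← iteratedDeriv_succ']; exact h.2 _⟩

lemma IsFlat.isLittleO {r : ℝ → ℂ} (h : IsFlat r) (n : ℕ) : r =o[𝓝 0] fun x => x ^ n := by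
  have := taylor_isLittleO_univ (x₀ := 0) (contDiff_infty.1 h.1 n)
  have h2 : ∀ x, taylorWithinEval r n Set.univ 0 x = 0 := by
    intro x
    rw [taylor_within_apply]
    refine Finset.sum_eq_zero fun k _ => ?_
    rw [iteratedDerivWithin_univ, h.2, smul_zero]
  simpa [h2] using this

noncomputable def flatSq (r : ℝ → ℂ) (n : ℕ) (x : ℝ) : ℂ := ((√x) ^ n)⁻¹ • r (√x)

lemma flatSq_hasDerivAt {r : ℝ → ℂ} (h : IsFlat r) (n : ℕ) (x : ℝ) :
    HasDerivAt (flatSq r n)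
      ((1 / 2 : ℝ) • flatSq (deriv r) (n + 1) x - (n / 2 : ℝ) • flatSq r (n + 2) x) x := by
  have r0 : r 0 = 0 := by simpa using h.2 0
  have r1 : deriv r 0 = 0 := by simpa using h.2 1
  rcases lt_trichotomy x 0 with hx | rfl | hx
  · have e : flatSq r n =ᶠ[𝓝 x] fun _ => 0 := by
      filter_upwards [Iio_mem_nhds hx] with y hy
      simp [flatSq, Real.sqrt_eq_zero_of_nonpos (le_of_lt hy), r0]
    refine ((hasDerivAt_const x (0 : ℂ)).congr_of_eventuallyEq e).congr_deriv ?_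
    simp [flatSq, Real.sqrt_eq_zero_of_nonpos hx.le, r0, r1]
  · have e0 : flatSq r n 0 = 0 := by simp [flatSq, r0]
    have e1 : (1 / 2 : ℝ) • flatSq (deriv r) (n + 1) 0 - (n / 2 : ℝ) • flatSq r (n + 2) 0 = 0 := by
      simp [flatSq, r0, r1]
    rw [e1, hasDerivAt_iff_isLittleO]
    simp only [e0, sub_zero, smul_zero]
    have hs : Filter.Tendsto Real.sqrt (𝓝 0) (𝓝 0) := by
      simpa using Real.continuous_sqrt.tendsto 0
    have h1 := (h.isLittleO (n + 2)).comp_tendsto hs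
    rw [Asymptotics.isLittleO_iff] at h1 ⊢
    intro c hc
    filter_upwards [h1 hc] with y hy
    rcases le_or_gt y 0 with hy0 | hy0
    · simp only [flatSq, Real.sqrt_eq_zero_of_nonpos hy0, r0, smul_zero, norm_zero]
      positivity
    · have hs0 : 0 < √y := Real.sqrt_pos.2 hy0
      simp only [flatSq, Function.comp_apply] at hy ⊢
      rw [norm_smul, norm_inv, Real.norm_of_nonneg (by positivity), inv_mul_le_iff₀ (by positivity)]
      rw [Real.norm_of_nonneg (by positivity), pow_add, Real.sq_sqrt hy0.le] at hy
      rw [Real.norm_of_nonneg hy0.le]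
      linarith
  · have hs0 : 0 < √x := Real.sqrt_pos.2 hx
    have hsq := Real.hasDerivAt_sqrt hx.ne'
    have hr : HasDerivAt r (deriv r (√x)) (√x) :=
      ((contDiff_infty_iff_deriv.1 h.1).1 _).hasDerivAt
    have h2 := ((hsq.pow n).inv (pow_ne_zero n hs0.ne')).smul (hr.scomp x hsq)
    refine h2.congr_deriv ?_
    simp only [flatSq, Function.comp_apply, smul_smul, Pi.inv_apply, Pi.pow_apply]
    rw [sub_eq_add_neg, ← neg_smul]
    congr 2
    · field_simp
      ring
    · rcases Nat.eq_zero_or_pos n with rfl | hn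
      · simp
      · obtain ⟨m, rfl⟩ : ∃ m, n = m + 1 := ⟨n - 1, by omega⟩
        simp only [Nat.add_sub_cancel]
        push_cast
        field_simp
        ring

lemma flatSq_contDiff {r : ℝ → ℂ} (h : IsFlat r) (n : ℕ) : ContDiff ℝ ∞ (flatSq r n) := by
  rw [contDiff_infty]
  intro N
  induction N generalizing r n with
  | zero =>
    exact contDiff_zero.2 (continuous_iff_continuousAt.2 fun x => (flatSq_hasDerivAt h n x).continuousAt)
  | succ N ih =>
    have hd : deriv (flatSq r n) = fun x => (1 / 2 : ℝ) • flatSq (deriv r) (n + 1) x -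
        (n / 2 : ℝ) • flatSq r (n + 2) x := funext fun x => (flatSq_hasDerivAt h n x).deriv
    push_cast
    rw [contDiff_succ_iff_deriv, hd]
    refine ⟨fun x => (flatSq_hasDerivAt h n x).differentiableAt, by simp, ?_⟩
    exact ((ih h.deriv (n + 1)).const_smul _).sub ((ih h (n + 2)).const_smul _)

/-- One dimensional statement. -/
lemma whitney_pow {f : ℝ → ℂ} (hf : ContDiff ℝ ∞ f) (k : ℕ)
    (h0 : ∀ j, (∀ i, j ≠ k + 2 * i) → iteratedDeriv j f 0 = 0) :
    ∃ φ : ℝ → ℂ, ContDiff ℝ ∞ φ ∧ ∀ t : ℝ, 0 < t → f t = t ^ k • φ (t ^ 2) := by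
  obtain ⟨g, hg, hgd⟩ := borel_lemma
    (fun i => (((k + 2 * i).factorial : ℝ)⁻¹) • iteratedDeriv (k + 2 * i) f 0)
  have hr : IsFlat (fun t => f t - t ^ k • g (t ^ 2)) := by
    refine ⟨hf.sub (smx_pow hg k), fun j => ?_⟩
    rw [iteratedDeriv_fun_sub (smx_at hf _ _) (smx_at (smx_pow hg k) _ _)]
    have h := iter_pow_sq j k g hg
    by_cases hj : ∃ i, j = k + 2 * i
    · obtain ⟨i, rfl⟩ := hj
      rw [h.1 i rfl, hgd, smul_smul, smul_smul]
      have h1 : ((k + 2 * i).factorial : ℝ) ≠ 0 := by positivity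
      have h2 : (i.factorial : ℝ) ≠ 0 := by positivity
      rw [show ((k + 2 * i).factorial : ℝ) / i.factorial * i.factorial *
        ((k + 2 * i).factorial : ℝ)⁻¹ = 1 by field_simp]
      simp
    · push Not at hj
      rw [h.2 hj, h0 j hj, sub_zero]
  refine ⟨fun x => g x + flatSq _ k x, hg.add (flatSq_contDiff hr k), fun t ht => ?_⟩
  simp only [flatSq, Real.sqrt_sq ht.le]
  rw [smul_add, smul_smul, mul_inv_cancel₀ (by positivity), one_smul]
  ring

/-- Weight `k` functions. -/
def HasWeight (F : ℂ → ℂ) (k : ℤ) : Prop := ∀ (ψ : ℝ) (z : ℂ), z ≠ 0 →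
  F (Complex.exp (ψ * Complex.I) * z) = Complex.exp (k * ψ * Complex.I) * F z

lemma weight_zero {F : ℂ → ℂ} (hF : Continuous F) {k : ℤ} (hw : HasWeight F k) (hk : k ≠ 0) :
    F 0 = 0 := by
  have h2 : ∀ z : ℂ, F (Complex.exp ((Real.pi / k : ℝ) * Complex.I) * z) = - F z := by
    have hE : Set.EqOn (fun z : ℂ => F (Complex.exp ((Real.pi / k : ℝ) * Complex.I) * z))
      (fun z => - F z) {0}ᶜ := by
      intro z hz
      have := hw (Real.pi / k) z hz
      simp only
      rw [this]
      have e : (k : ℂ) * ((Real.pi / k : ℝ) : ℂ) * Complex.I = Real.pi * Complex.I := by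
        have : (k : ℂ) ≠ 0 := by exact_mod_cast hk
        push_cast
        field_simp
      rw [e, Complex.exp_pi_mul_I]
      ring
    have := Continuous.ext_on (dense_compl_singleton (0 : ℂ)) (by fun_prop) (by fun_prop) hE
    exact fun z => congrFun this z
  have := h2 0
  rw [mul_zero] at this
  exact self_eq_neg.1 this

lemma weight_fderiv {F : ℂ → ℂ} (hF : ContDiff ℝ ∞ F) {k : ℤ} (hw : HasWeight F k)
    (ψ : ℝ) (z : ℂ) (hz : z ≠ 0) (v : ℂ) :
    fderiv ℝ F (Complex.exp (ψ * Complex.I) * z) v =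
      Complex.exp (k * ψ * Complex.I) * fderiv ℝ F z (Complex.exp (-(ψ * Complex.I)) * v) := by
  have hd : Differentiable ℝ F := hF.differentiable (by simp)
  set w := Complex.exp (ψ * Complex.I) with hwdef
  have h1 : HasFDerivAt (fun z => F (w * z))
      ((fderiv ℝ F (w * z)).comp (w • ContinuousLinearMap.id ℝ ℂ)) z :=
    (hd _).hasFDerivAt.comp z ((hasFDerivAt_id z).const_smul w)
  have h2 : HasFDerivAt (fun z => Complex.exp (k * ψ * Complex.I) * F z)
      (Complex.exp (k * ψ * Complex.I) • fderiv ℝ F z) z :=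
    (hd z).hasFDerivAt.const_smul (Complex.exp (k * ψ * Complex.I))
  have h3 : (fun z => F (w * z)) =ᶠ[𝓝 z] (fun z => Complex.exp (k * ψ * Complex.I) * F z) := by
    filter_upwards [isOpen_ne.mem_nhds hz] with y hy
    exact hw ψ y hy
  have h4 := h1.unique (h2.congr_of_eventuallyEq h3)
  have h5 := DFunLike.congr_fun h4 (Complex.exp (-(ψ * Complex.I)) * v)
  simp only [ContinuousLinearMap.comp_apply, ContinuousLinearMap.smul_apply,
    ContinuousLinearMap.id_apply, smul_eq_mul] at h5
  rw [← h5, ← mul_assoc, hwdef, ← Complex.exp_add]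
  simp

lemma exp_neg_mul (L : ℂ →L[ℝ] ℂ) (ψ : ℝ) :
    L (Complex.exp (-(ψ * Complex.I)) * 1) = Real.cos ψ * L 1 - Real.sin ψ * L Complex.I ∧
    L (Complex.exp (-(ψ * Complex.I)) * Complex.I) =
      Real.sin ψ * L 1 + Real.cos ψ * L Complex.I := by
  have e : Complex.exp (-(ψ * Complex.I)) = Real.cos ψ - Real.sin ψ * Complex.I := by
    rw [show -((ψ : ℂ) * Complex.I) = ((-ψ : ℝ) : ℂ) * Complex.I by push_cast; ring,
      Complex.exp_mul_I, ← Complex.ofReal_cos, ← Complex.ofReal_sin, Real.cos_neg, Real.sin_neg]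
    push_cast; ring
  constructor
  · rw [e, show ((Real.cos ψ : ℂ) - Real.sin ψ * Complex.I) * 1 =
      Real.cos ψ • (1 : ℂ) - Real.sin ψ • Complex.I by simp, map_sub, map_smul, map_smul]
    simp
  · rw [e, show ((Real.cos ψ : ℂ) - Real.sin ψ * Complex.I) * Complex.I =
      Real.sin ψ • (1 : ℂ) + Real.cos ψ • Complex.I by
        simp [sub_mul, mul_assoc]; ring, map_add, map_smul, map_smul]
    simp

lemma weight_iter (j : ℕ) : ∀ (F : ℂ → ℂ) (k : ℤ), ContDiff ℝ ∞ F → HasWeight F k →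
    (∀ i : ℕ, j ≠ k.natAbs + 2 * i) → iteratedDeriv j (fun t : ℝ => F t) 0 = 0 := by
  induction j with
  | zero =>
    intro F k hF hw h
    have := weight_zero hF.continuous hw (by have := h 0; omega)
    simpa using this
  | succ j ih =>
    intro F k hF hw h
    have hd : Differentiable ℝ F := hF.differentiable (by simp)
    have hD : ∀ v : ℂ, ContDiff ℝ ∞ (fun z => fderiv ℝ F z v) := fun v =>
      (hF.fderiv_right (m := ∞) (by simp)).clm_apply contDiff_const
    let A : ℂ → ℂ := fun z => (1 / 2 : ℂ) * (fderiv ℝ F z 1 - Complex.I * fderiv ℝ F z Complex.I)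
    let B : ℂ → ℂ := fun z => (1 / 2 : ℂ) * (fderiv ℝ F z 1 + Complex.I * fderiv ℝ F z Complex.I)
    have hA : ContDiff ℝ ∞ A :=
      contDiff_const.mul ((hD 1).sub (contDiff_const.mul (hD Complex.I)))
    have hB : ContDiff ℝ ∞ B :=
      contDiff_const.mul ((hD 1).add (contDiff_const.mul (hD Complex.I)))
    have hwA : HasWeight A (k - 1) := by
      intro ψ z hz
      simp only [A]
      rw [weight_fderiv hF hw ψ z hz, weight_fderiv hF hw ψ z hz, (exp_neg_mul _ ψ).1,
        (exp_neg_mul _ ψ).2]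
      have e : Complex.exp (((k - 1 : ℤ) : ℂ) * ψ * Complex.I) =
          Complex.exp (k * ψ * Complex.I) * (Real.cos ψ - Real.sin ψ * Complex.I) := by
        rw [show ((k - 1 : ℤ) : ℂ) * ψ * Complex.I = k * ψ * Complex.I +
          ((-ψ : ℝ) : ℂ) * Complex.I by push_cast; ring, Complex.exp_add, Complex.exp_mul_I (-ψ : ℝ),
          ← Complex.ofReal_cos, ← Complex.ofReal_sin, Real.cos_neg, Real.sin_neg]
        push_cast; ring
      rw [e]
      linear_combination (-(1 / 2 : ℂ) * Complex.exp (k * ψ * Complex.I) * Real.sin ψ *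
        fderiv ℝ F z Complex.I) * Complex.I_sq
    have hwB : HasWeight B (k + 1) := by
      intro ψ z hz
      simp only [B]
      rw [weight_fderiv hF hw ψ z hz, weight_fderiv hF hw ψ z hz, (exp_neg_mul _ ψ).1,
        (exp_neg_mul _ ψ).2]
      have e : Complex.exp (((k + 1 : ℤ) : ℂ) * ψ * Complex.I) =
          Complex.exp (k * ψ * Complex.I) * (Real.cos ψ + Real.sin ψ * Complex.I) := by
        rw [show ((k + 1 : ℤ) : ℂ) * ψ * Complex.I = k * ψ * Complex.I +
          (ψ : ℂ) * Complex.I by push_cast; ring, Complex.exp_add, Complex.exp_mul_I (ψ : ℂ),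
          ← Complex.ofReal_cos, ← Complex.ofReal_sin]
      rw [e]
      linear_combination (-(1 / 2 : ℂ) * Complex.exp (k * ψ * Complex.I) * Real.sin ψ *
        fderiv ℝ F z Complex.I) * Complex.I_sq
    have hder : deriv (fun t : ℝ => F t) = fun t : ℝ => A t + B t := by
      funext t
      have h1 : HasDerivAt (fun t : ℝ => (t : ℂ)) 1 t := Complex.ofRealCLM.hasDerivAt
      have h2 : HasDerivAt (fun t : ℝ => F t) (fderiv ℝ F t 1) t :=
        (hd (t : ℂ)).hasFDerivAt.comp_hasDerivAt t h1
      rw [h2.deriv]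
      simp only [A, B]
      ring
    have hAr : ContDiff ℝ ∞ (fun t : ℝ => A t) := hA.comp Complex.ofRealCLM.contDiff
    have hBr : ContDiff ℝ ∞ (fun t : ℝ => B t) := hB.comp Complex.ofRealCLM.contDiff
    rw [iteratedDeriv_succ', hder, iteratedDeriv_fun_add (smx_at hAr _ _) (smx_at hBr _ _)]
    rw [ih A (k - 1) hA hwA, ih B (k + 1) hB hwB, add_zero]
    · intro i hi
      by_cases hk : 0 ≤ k
      · exact h (i + 1) (by omega)
      · exact h i (by omega)
    · intro i hi
      by_cases hk : 0 < k
      · exact h i (by omega)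
      · exact h (i + 1) (by omega)

lemma weight_forward {F : ℂ → ℂ} {k : ℤ} (hF : ContDiff ℝ ∞ F) (hw : HasWeight F k) :
    ∃ φ : ℝ → ℂ, ContDiff ℝ ∞ φ ∧ ∀ t : ℝ, 0 < t → F t = (t : ℂ) ^ k.natAbs * φ (t ^ 2) := by
  obtain ⟨φ, h1, h2⟩ := whitney_pow (f := fun t : ℝ => F t) (hF.comp Complex.ofRealCLM.contDiff)
    k.natAbs (fun j hj => weight_iter j F k hF hw hj)
  refine ⟨φ, h1, fun t ht => ?_⟩
  rw [h2 t ht]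
  simp

lemma weight_backward {F : ℂ → ℂ} {k : ℤ} (hw : HasWeight F k) {φ : ℝ → ℂ}
    (hφ : ContDiff ℝ ∞ φ) (h : ∀ t : ℝ, 0 < t → F t = (t : ℂ) ^ k.natAbs * φ (t ^ 2)) :
    ∃ G : ℂ → ℂ, ContDiff ℝ ∞ G ∧ ∀ z, z ≠ 0 → G z = F z := by
  have hsm : ContDiff ℝ ∞ (fun z : ℂ => φ (‖z‖ ^ 2)) := hφ.comp (contDiff_norm_sq ℝ)
  have hpol : ∀ z : ℂ, z ≠ 0 → F z = Complex.exp (k * z.arg * Complex.I) *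
      ((‖z‖ : ℂ) ^ k.natAbs * φ (‖z‖ ^ 2)) := by
    intro z hz
    have h1 := hw z.arg (‖z‖ : ℂ) (by simpa using hz)
    rw [h _ (norm_pos_iff.2 hz), mul_comm, Complex.norm_mul_exp_arg_mul_I] at h1
    exact h1
  rcases Int.natAbs_eq k with hk | hk
  · refine ⟨fun z => z ^ k.natAbs * φ (‖z‖ ^ 2), (contDiff_id.pow _).mul hsm, fun z hz => ?_⟩
    rw [hpol z hz]
    have : z ^ k.natAbs = Complex.exp (k * z.arg * Complex.I) * (‖z‖ : ℂ) ^ k.natAbs := by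
      conv_lhs => rw [← Complex.norm_mul_exp_arg_mul_I z]
      rw [mul_pow, ← Complex.exp_nat_mul, mul_comm]
      congr 2
      have : (k : ℂ) = (k.natAbs : ℂ) := by
        conv_lhs => rw [hk]
        rw [Int.cast_natCast]
      rw [this]; ring
    simp only [this]; ring
  · refine ⟨fun z => (starRingEnd ℂ z) ^ k.natAbs * φ (‖z‖ ^ 2),
      (Complex.conjCLE.contDiff.pow _).mul hsm, fun z hz => ?_⟩
    rw [hpol z hz]
    have : (starRingEnd ℂ z) ^ k.natAbs =
        Complex.exp (k * z.arg * Complex.I) * (‖z‖ : ℂ) ^ k.natAbs := by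
      conv_lhs => rw [← Complex.norm_mul_exp_arg_mul_I z]
      rw [map_mul, ← Complex.exp_conj, mul_pow, ← Complex.exp_nat_mul, mul_comm, map_mul,
        Complex.conj_I, Complex.conj_ofReal, Complex.conj_ofReal]
      congr 2
      have : (k : ℂ) = -(k.natAbs : ℂ) := by
        conv_lhs => rw [hk]
        rw [Int.cast_neg, Int.cast_natCast]
      rw [this]; ring
    simp only [this]; ring

noncomputable def mP (M : Matrix (Fin 2) (Fin 2) ℝ) : ℂ := ⟨(M 0 0 + M 1 1) / 2, (M 1 0 - M 0 1) / 2⟩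
noncomputable def mQ (M : Matrix (Fin 2) (Fin 2) ℝ) : ℂ := ⟨(M 0 0 - M 1 1) / 2, (M 1 0 + M 0 1) / 2⟩

lemma mP_rot (M : Matrix (Fin 2) (Fin 2) ℝ) (x y : ℝ) :
    mP (rotMat x * M * (rotMat y)ᵀ) = Complex.exp (((x - y : ℝ) : ℂ) * Complex.I) * mP M := by
  apply Complex.ext <;>
  · simp only [Complex.mul_re, Complex.mul_im, Complex.exp_ofReal_mul_I_re,
      Complex.exp_ofReal_mul_I_im, mP, rotMat, Matrix.mul_apply, Fin.sum_univ_two,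
      Matrix.transpose_apply, Matrix.of_apply, Matrix.cons_val_zero, Matrix.cons_val_one,
      Real.cos_sub, Real.sin_sub, Matrix.cons_val', Matrix.cons_val_fin_one]
    ring

lemma mQ_rot (M : Matrix (Fin 2) (Fin 2) ℝ) (x y : ℝ) :
    mQ (rotMat x * M * (rotMat y)ᵀ) = Complex.exp (((x + y : ℝ) : ℂ) * Complex.I) * mQ M := by
  apply Complex.ext <;>
  · simp only [Complex.mul_re, Complex.mul_im, Complex.exp_ofReal_mul_I_re,
      Complex.exp_ofReal_mul_I_im, mQ, rotMat, Matrix.mul_apply, Fin.sum_univ_two,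
      Matrix.transpose_apply, Matrix.of_apply, Matrix.cons_val_zero, Matrix.cons_val_one,
      Real.cos_add, Real.sin_add, Matrix.cons_val', Matrix.cons_val_fin_one]
    ring

lemma contDiff_mk {f g : ℂ → ℝ} (hf : ContDiff ℝ ∞ f) (hg : ContDiff ℝ ∞ g) :
    ContDiff ℝ ∞ (fun z => (⟨f z, g z⟩ : ℂ)) := by
  have : (fun z => (⟨f z, g z⟩ : ℂ)) = fun z => (f z : ℂ) + (g z : ℂ) * Complex.I := by
    funext z; exact Complex.mk_eq_add_mul_I _ _
  rw [this]
  exact (Complex.ofRealCLM.contDiff.comp hf).add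
    ((Complex.ofRealCLM.contDiff.comp hg).mul contDiff_const)

theorem smooth_extension_iff_mixed_products
    (a d₁ d₂ : ℕ) (ha : 0 < a) (hd₁ : 0 < d₁) (hd₂ : 0 < d₂)
    (hdvd₁ : (a : ℤ) ∣ (d₁ : ℤ) - (d₂ : ℤ)) (hdvd₂ : a ∣ d₁ + d₂)
    (H : ℂ → Matrix (Fin 2) (Fin 2) ℝ)
    (hsmooth : ∀ i j : Fin 2, ContDiffOn ℝ (⊤ : ℕ∞) (fun z => H z i j) {0}ᶜ)
    (hequiv : ∀ (θ : ℝ) (z : ℂ), z ≠ 0 →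
      H (Complex.exp ((a * θ : ℝ) * Complex.I) * z) =
        rotMat (d₁ * θ) * H z * (rotMat (d₂ * θ))ᵀ) :
    (∃ He : ℂ → Matrix (Fin 2) (Fin 2) ℝ,
        (∀ i j : Fin 2, ContDiff ℝ (⊤ : ℕ∞) fun z => He z i j) ∧
        ∀ z : ℂ, z ≠ 0 → He z = H z) ↔
      ∃ φ₁ φ₂ φ₃ φ₄ : ℝ → ℝ,
        ContDiff ℝ (⊤ : ℕ∞) φ₁ ∧ ContDiff ℝ (⊤ : ℕ∞) φ₂ ∧
        ContDiff ℝ (⊤ : ℕ∞) φ₃ ∧ ContDiff ℝ (⊤ : ℕ∞) φ₄ ∧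
        ∀ t : ℝ, 0 < t →
          H (t : ℂ) 0 0 =
              t ^ (((d₁ : ℤ) - (d₂ : ℤ)).natAbs / a) * φ₁ (t ^ 2) +
                t ^ ((d₁ + d₂) / a) * φ₃ (t ^ 2) ∧
          H (t : ℂ) 1 1 =
              t ^ (((d₁ : ℤ) - (d₂ : ℤ)).natAbs / a) * φ₁ (t ^ 2) -
                t ^ ((d₁ + d₂) / a) * φ₃ (t ^ 2) ∧
          H (t : ℂ) 0 1 =
              t ^ (((d₁ : ℤ) - (d₂ : ℤ)).natAbs / a) * φ₂ (t ^ 2) +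
                t ^ ((d₁ + d₂) / a) * φ₄ (t ^ 2) ∧
          H (t : ℂ) 1 0 =
              -(t ^ (((d₁ : ℤ) - (d₂ : ℤ)).natAbs / a) * φ₂ (t ^ 2)) +
                t ^ ((d₁ + d₂) / a) * φ₄ (t ^ 2) := by
  obtain ⟨c₁, hc₁⟩ := hdvd₁
  obtain ⟨c₂, hc₂⟩ := hdvd₂
  have haR : (a : ℝ) ≠ 0 := by exact_mod_cast ha.ne'
  have e₁ : ((d₁ : ℤ) - (d₂ : ℤ)).natAbs / a = c₁.natAbs := by
    rw [hc₁, Int.natAbs_mul, Int.natAbs_natCast, Nat.mul_div_cancel_left _ ha]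
  have e₂ : (d₁ + d₂) / a = (c₂ : ℤ).natAbs := by
    rw [hc₂, Nat.mul_div_cancel_left _ ha, Int.natAbs_natCast]
  rw [e₁, e₂]
  have r₁ : (d₁ : ℝ) - d₂ = a * c₁ := by exact_mod_cast hc₁
  have r₂ : (d₁ : ℝ) + d₂ = a * c₂ := by exact_mod_cast hc₂
  have hrot : ∀ (ψ : ℝ) (z : ℂ), z ≠ 0 → H (Complex.exp (ψ * Complex.I) * z) =
      rotMat (d₁ * (ψ / a)) * H z * (rotMat (d₂ * (ψ / a)))ᵀ := by
    intro ψ z hz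
    rw [← hequiv (ψ / a) z hz, mul_div_cancel₀ _ haR]
  have hwP : HasWeight (fun z => mP (H z)) c₁ := by
    intro ψ z hz
    simp only
    rw [hrot ψ z hz, mP_rot, ← sub_mul, r₁]
    congr 3
    rw [show (a : ℝ) * c₁ * (ψ / a) = c₁ * ψ by field_simp]
    push_cast; rfl
  have hwQ : HasWeight (fun z => mQ (H z)) (c₂ : ℤ) := by
    intro ψ z hz
    simp only
    rw [hrot ψ z hz, mQ_rot, ← add_mul, r₂]
    congr 3
    rw [show (a : ℝ) * c₂ * (ψ / a) = c₂ * ψ by field_simp]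
    push_cast; rfl
  have hre : ∀ {φ : ℝ → ℂ}, ContDiff ℝ ∞ φ → ContDiff ℝ ∞ (fun x => (φ x).re) :=
    fun h => Complex.reCLM.contDiff.comp h
  have him : ∀ {φ : ℝ → ℂ}, ContDiff ℝ ∞ φ → ContDiff ℝ ∞ (fun x => (φ x).im) :=
    fun h => Complex.imCLM.contDiff.comp h
  constructor
  · rintro ⟨He, hHe, hEq⟩
    have hP : ContDiff ℝ ∞ (fun z => mP (He z)) :=
      contDiff_mk (((hHe 0 0).add (hHe 1 1)).div_const 2) (((hHe 1 0).sub (hHe 0 1)).div_const 2)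
    have hQ : ContDiff ℝ ∞ (fun z => mQ (He z)) :=
      contDiff_mk (((hHe 0 0).sub (hHe 1 1)).div_const 2) (((hHe 1 0).add (hHe 0 1)).div_const 2)
    have hwP' : HasWeight (fun z => mP (He z)) c₁ := by
      intro ψ z hz
      simp only
      rw [hEq z hz, hEq _ (mul_ne_zero (Complex.exp_ne_zero _) hz)]
      exact hwP ψ z hz
    have hwQ' : HasWeight (fun z => mQ (He z)) (c₂ : ℤ) := by
      intro ψ z hz
      simp only
      rw [hEq z hz, hEq _ (mul_ne_zero (Complex.exp_ne_zero _) hz)]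
      exact hwQ ψ z hz
    obtain ⟨φ, hφ, h1⟩ := weight_forward hP hwP'
    obtain ⟨χ, hχ, h2⟩ := weight_forward hQ hwQ'
    refine ⟨fun x => (φ x).re, fun x => -(φ x).im, fun x => (χ x).re, fun x => (χ x).im,
      hre hφ, (him hφ).neg, hre hχ, him hχ, fun t ht => ?_⟩
    have p := h1 t ht
    have q := h2 t ht
    rw [hEq t (by exact_mod_cast ht.ne'), ← Complex.ofReal_pow] at p q
    have p1 := congrArg Complex.re p
    have p2 := congrArg Complex.im p
    have q1 := congrArg Complex.re q
    have q2 := congrArg Complex.im q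
    rw [Complex.re_ofReal_mul] at p1 q1
    rw [Complex.im_ofReal_mul] at p2 q2
    simp only [mP, mQ] at p1 p2 q1 q2
    refine ⟨?_, ?_, ?_, ?_⟩ <;> linarith
  · rintro ⟨φ₁, φ₂, φ₃, φ₄, h₁, h₂, h₃, h₄, h⟩
    have hmk : ∀ {f g : ℝ → ℝ}, ContDiff ℝ ∞ f → ContDiff ℝ ∞ g →
        ContDiff ℝ ∞ (fun x => (f x : ℂ) + (g x : ℂ) * Complex.I) := fun hf hg =>
      (Complex.ofRealCLM.contDiff.comp hf).add
        ((Complex.ofRealCLM.contDiff.comp hg).mul contDiff_const)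
    obtain ⟨P, hP, hPe⟩ := weight_backward hwP (hmk h₁ h₂.neg) (by
      intro t ht
      obtain ⟨a1, a2, a3, a4⟩ := h t ht
      rw [← Complex.ofReal_pow]
      apply Complex.ext
      · rw [Complex.re_ofReal_mul]; simp [mP]; linarith
      · rw [Complex.im_ofReal_mul]; simp [mP]; linarith)
    obtain ⟨Q, hQ, hQe⟩ := weight_backward hwQ (hmk h₃ h₄) (by
      intro t ht
      obtain ⟨a1, a2, a3, a4⟩ := h t ht
      rw [← Complex.ofReal_pow]
      apply Complex.ext
      · rw [Complex.re_ofReal_mul]; simp [mQ] at *; linarith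
      · rw [Complex.im_ofReal_mul]; simp [mQ] at *; linarith)
    have hPr : ContDiff ℝ ∞ (fun z => (P z).re) := Complex.reCLM.contDiff.comp hP
    have hPi : ContDiff ℝ ∞ (fun z => (P z).im) := Complex.imCLM.contDiff.comp hP
    have hQr : ContDiff ℝ ∞ (fun z => (Q z).re) := Complex.reCLM.contDiff.comp hQ
    have hQi : ContDiff ℝ ∞ (fun z => (Q z).im) := Complex.imCLM.contDiff.comp hQ
    refine ⟨fun z => !![(P z).re + (Q z).re, (Q z).im - (P z).im;
      (Q z).im + (P z).im, (P z).re - (Q z).re], ?_, ?_⟩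
    · intro i j
      fin_cases i <;> fin_cases j
      · exact hPr.add hQr
      · exact hQi.sub hPi
      · exact hQi.add hPi
      · exact hPr.sub hQr
    · intro z hz
      simp only [hPe z hz, hQe z hz]
      ext i j
      fin_cases i <;> fin_cases j <;> simp [mP, mQ] <;> ring
end

section
/- Let a and d be positive integers with a dividing d, and set q = d/a. Let B(θ) be the 3×3 block-diagonal matrix diag(R(dθ), 1). Let G : ℂ \ {0} → M₃(ℝ) be a C^∞ function taking symmetric matrix values and satisfying G(e^{iaθ}z) = B(θ)·G(z)·B(θ)ᵀ for all θ ∈ ℝ and z ∈ ℂ \ {0}. Then G extends to a C^∞ function on all of ℂ if and only if there exist C^∞ functions φ₁, …, φ₆ : ℝ → ℝ such that for all real t > 0: G(t)₁₁ = φ₁(t²) + t^{2q}·φ₂(t²), G(t)₂₂ = φ₁(t²) − t^{2q}·φ₂(t²), G(t)₁₂ = t^{2q}·φ₃(t²), G(t)₁₃ = t^q·φ₄(t²), G(t)₂₃ = t^q·φ₅(t²), and G(t)₃₃ = φ₆(t²). -/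
open Matrix

/-- The 3×3 block-diagonal matrix `diag(R(θ), 1)` where `R(θ)` is the
2×2 rotation matrix. -/
noncomputable def blockRot3 (θ : ℝ) : Matrix (Fin 3) (Fin 3) ℝ :=
  !![Real.cos θ, -Real.sin θ, 0; Real.sin θ, Real.cos θ, 0; 0, 0, 1]

section Aux
open Filter Topology Asymptotics

lemma aux_taylor (g : ℝ → ℝ) (hg : ContDiff ℝ (⊤ : ℕ∞) g) (n : ℕ) :
    (fun x => g x - ∑ k ∈ Finset.range (n + 1), iteratedDeriv k g 0 / (k.factorial : ℝ) * x ^ k)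
      =o[𝓝 0] fun x => x ^ n := by
  have h := taylor_isLittleO_univ (f := g) (x₀ := 0) (n := n) (hg.of_le (by exact_mod_cast le_top))
  simp only [taylor_within_apply, sub_zero, iteratedDerivWithin_univ, smul_eq_mul] at h
  refine h.congr_left fun x => ?_
  congr 1
  refine Finset.sum_congr rfl fun k _ => ?_
  ring

lemma aux_flat_of_isLittleO (r : ℝ → ℝ) (hr : ContDiff ℝ (⊤ : ℕ∞) r)
    (h : ∀ N : ℕ, r =o[𝓝 0] fun x => x ^ N) (n : ℕ) : iteratedDeriv n r 0 = 0 := by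
  induction n using Nat.strong_induction_on with
  | _ n ih =>
    have h1 := (h n).sub (aux_taylor r hr n)
    have h2 : (fun x : ℝ => iteratedDeriv n r 0 / (n.factorial : ℝ) * x ^ n) =o[𝓝 0]
        fun x => x ^ n := by
      refine h1.congr_left fun x => ?_
      rw [Finset.sum_range_succ, Finset.sum_eq_zero]
      · ring
      · intro k hk
        rw [ih k (Finset.mem_range.1 hk)]; simp
    by_contra hne
    have h3 : (fun x : ℝ => x ^ n) =o[𝓝 0] fun x : ℝ => x ^ n :=
      (isLittleO_const_mul_left_iff
        (div_ne_zero hne (by exact_mod_cast n.factorial_ne_zero))).1 h2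
    have h4 : (fun x : ℝ => x ^ n) =o[𝓝[≠] 0] fun x : ℝ => x ^ n := h3.mono nhdsWithin_le_nhds
    have h5 := isLittleO_irrefl' (l := 𝓝[≠] (0:ℝ)) (f' := fun x : ℝ => x ^ n) ?_
    · exact h5 h4
    · apply Eventually.frequently
      filter_upwards [self_mem_nhdsWithin] with x hx
      exact norm_ne_zero_iff.2 (pow_ne_zero n hx)

lemma aux_isLittleO_of_flat (r : ℝ → ℝ) (hr : ContDiff ℝ (⊤ : ℕ∞) r)
    (h : ∀ n : ℕ, iteratedDeriv n r 0 = 0) (N : ℕ) : r =o[𝓝 0] fun x => x ^ N := by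
  refine (aux_taylor r hr N).congr_left fun x => ?_
  simp [h]

lemma aux_flat_cont (r : ℝ → ℝ) (hr : ContDiff ℝ (⊤ : ℕ∞) r)
    (h : ∀ n : ℕ, iteratedDeriv n r 0 = 0) (m : ℕ) :
    ContinuousAt (fun s => r (√s) / (√s) ^ m) 0 := by
  have h1 : ContinuousAt (fun x => r x / x ^ m) 0 := by
    have := (aux_isLittleO_of_flat r hr h m).tendsto_div_nhds_zero
    have h0 : r 0 = 0 := by simpa using h 0
    simpa [ContinuousAt, h0] using this
  have h2 : ContinuousAt (fun x => r x / x ^ m) (√0) := by simpa using h1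
  exact h2.comp (f := Real.sqrt) Real.continuous_sqrt.continuousAt

lemma aux_flat_sqrt (n : ℕ) : ∀ (m : ℕ) (r : ℝ → ℝ), ContDiff ℝ (⊤ : ℕ∞) r →
    (∀ n : ℕ, iteratedDeriv n r 0 = 0) → ContDiff ℝ n (fun s => r (√s) / (√s) ^ m) := by
  have key : ∀ (m : ℕ) (r : ℝ → ℝ), ContDiff ℝ (⊤ : ℕ∞) r →
    (∀ n : ℕ, iteratedDeriv n r 0 = 0) → ∀ s, HasDerivAt (fun s => r (√s) / (√s) ^ m)
      ((deriv r (√s) / (√s) ^ (m + 1) - m * (r (√s) / (√s) ^ (m + 2))) / 2) s := by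
    intro m r hr h
    have h0 : r 0 = 0 := by simpa using h 0
    have hr' : ContDiff ℝ (⊤ : ℕ∞) (deriv r) := (contDiff_infty_iff_deriv.1 hr).2
    have h' : ∀ n : ℕ, iteratedDeriv n (deriv r) 0 = 0 := fun n => by
      rw [← iteratedDeriv_succ']; exact h _
    have h0' : deriv r 0 = 0 := by simpa using h' 0
    refine hasDerivAt_of_hasDerivAt_of_ne' (x := 0) ?_ (aux_flat_cont r hr h m) ?_
    · intro s hs
      rcases lt_or_gt_of_ne hs with hs | hs
      · have e : (fun s => r (√s) / (√s) ^ m) =ᶠ[𝓝 s] fun _ => 0 := by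
          filter_upwards [Iio_mem_nhds hs] with x hx
          rw [Real.sqrt_eq_zero_of_nonpos (le_of_lt hx), h0, zero_div]
        have := (hasDerivAt_const s (0:ℝ)).congr_of_eventuallyEq e
        simpa [Real.sqrt_eq_zero_of_nonpos hs.le, h0, h0'] using this
      · have hp : √s ≠ 0 := (Real.sqrt_pos.2 hs).ne'
        have d1 := Real.hasDerivAt_sqrt hs.ne'
        have d2 : HasDerivAt r (deriv r (√s)) (√s) :=
          ((contDiff_infty_iff_deriv.1 hr).1 _).hasDerivAt
        have d3 := (d2.comp s d1).div (d1.pow m) (pow_ne_zero m hp)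
        refine d3.congr_deriv ?_
        simp only [Function.comp, Pi.pow_apply]
        rcases m with _ | m
        · simp; field_simp
        · simp only [Nat.add_sub_cancel]; field_simp; ring
    · exact ((aux_flat_cont _ hr' h' (m+1)).sub
        (continuousAt_const.mul (aux_flat_cont r hr h (m+2)))).div_const 2
  induction n with
  | zero =>
    intro m r hr h
    simp only [Nat.cast_zero, contDiff_zero]
    exact continuous_iff_continuousAt.2 fun s => (key m r hr h s).continuousAt
  | succ n ih =>
    intro m r hr h
    have hr' : ContDiff ℝ (⊤ : ℕ∞) (deriv r) := (contDiff_infty_iff_deriv.1 hr).2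
    have h' : ∀ n : ℕ, iteratedDeriv n (deriv r) 0 = 0 := fun n => by
      rw [← iteratedDeriv_succ']; exact h _
    push_cast
    rw [contDiff_succ_iff_deriv]
    refine ⟨fun s => (key m r hr h s).differentiableAt, by simp, ?_⟩
    rw [funext fun s => (key m r hr h s).deriv]
    exact ((ih _ _ hr' h').sub (contDiff_const.mul (ih _ _ hr h))).div_const 2

lemma aux_borel (c : ℕ → ℝ) : ∃ ψ : ℝ → ℝ, ContDiff ℝ (⊤ : ℕ∞) ψ ∧
    ∀ n, iteratedDeriv n ψ 0 = n.factorial * c n := by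
  let χ : ContDiffBump (0 : ℝ) := ⟨1, 2, by norm_num, by norm_num⟩
  let u : ℕ → ℝ → ℝ := fun n s => s ^ n * χ s
  have hu : ∀ n, ContDiff ℝ (⊤ : ℕ∞) (u n) := fun n => (contDiff_id.pow n).mul χ.contDiff
  have hsupp : ∀ n, HasCompactSupport (u n) := fun n => χ.hasCompactSupport.mul_left
  have hb : ∀ n k, ∃ C, ∀ x, ‖iteratedDeriv k (u n) x‖ ≤ C := by
    intro n k
    obtain ⟨C, hC⟩ := ((hsupp n).iteratedFDeriv (𝕜 := ℝ) k).exists_bound_of_continuous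
      ((hu n).continuous_iteratedFDeriv (m := k) (by exact_mod_cast le_top))
    exact ⟨C, fun x => by rw [← norm_iteratedFDeriv_eq_norm_iteratedDeriv]; exact hC x⟩
  choose C hC using hb
  have hC0 : ∀ n k, 0 ≤ C n k := fun n k => (norm_nonneg _).trans (hC n k 0)
  let M : ℕ → ℝ := fun n => ∑ k ∈ Finset.range n, C n k
  have hM : ∀ n k, k < n → C n k ≤ M n := fun n k hk =>
    Finset.single_le_sum (f := C n) (fun i _ => hC0 n i) (Finset.mem_range.2 hk)
  have hM0 : ∀ n, 0 ≤ M n := fun n => Finset.sum_nonneg fun i _ => hC0 n i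
  let L : ℕ → ℝ := fun n => 1 + 2 ^ n * |c n| * M n
  have hL1 : ∀ n, 1 ≤ L n := fun n => by
    have := hM0 n
    simp only [L]; have : 0 ≤ 2 ^ n * |c n| * M n := by positivity
    linarith
  let f : ℕ → ℝ → ℝ := fun n s => (c n / L n ^ n) * u n (L n * s)
  have hf : ∀ n, ContDiff ℝ (⊤ : ℕ∞) (f n) := fun n =>
    contDiff_const.mul ((hu n).comp (contDiff_const.mul contDiff_id))
  have hfd : ∀ n k x, iteratedDeriv k (f n) x =
      (c n / L n ^ n) * (L n ^ k * iteratedDeriv k (u n) (L n * x)) := by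
    intro n k x
    simp only [f]
    rw [iteratedDeriv_const_mul_field,
      iteratedDeriv_comp_const_mul ((hu n).of_le (by exact_mod_cast le_top))]
  let v : ℕ → ℕ → ℝ := fun k n => if k < n then (1/2 : ℝ) ^ n else
    |c n / L n ^ n| * (L n ^ k * C n k)
  have hv : ∀ k : ℕ, (k : ℕ∞) ≤ (⊤ : ℕ∞) → Summable (v k) := by
    intro k _
    rw [← summable_nat_add_iff (k + 1)]
    have : (fun n => v k (n + (k + 1))) = fun n => (1/2 : ℝ) ^ (n + (k + 1)) := by
      ext n; simp only [v]; rw [if_pos (by omega)]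
    rw [this, summable_nat_add_iff (f := fun n => (1/2 : ℝ) ^ n) (k + 1)]
    exact summable_geometric_two
  have hfv : ∀ (k n : ℕ) (x : ℝ), (k : ℕ∞) ≤ (⊤ : ℕ∞) → ‖iteratedFDeriv ℝ k (f n) x‖ ≤ v k n := by
    intro k n x _
    have hL := hL1 n
    have hLp : 0 < L n := by linarith
    rw [norm_iteratedFDeriv_eq_norm_iteratedDeriv, hfd, norm_mul, norm_mul, norm_pow,
      Real.norm_eq_abs (L n), abs_of_pos hLp, Real.norm_eq_abs (c n / _)]
    simp only [v]
    split_ifs with hk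
    · have h1 : ‖iteratedDeriv k (u n) (L n * x)‖ ≤ M n := (hC n k _).trans (hM n k hk)
      have h2 : |c n / L n ^ n| = |c n| / L n ^ n := by
        rw [abs_div, abs_of_pos (pow_pos hLp n)]
      rw [h2]
      have h3 : L n ^ k * L n ≤ L n ^ n := by
        rw [← pow_succ]; exact pow_le_pow_right₀ hL hk
      have h4 : 2 ^ n * |c n| * M n ≤ L n := by simp only [L]; linarith
      have h5 : |c n| * M n ≤ (1/2) ^ n * L n := by
        rw [one_div, inv_pow, inv_mul_eq_div, le_div_iff₀ (by positivity)]
        linarith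
      rw [div_mul_eq_mul_div, div_le_iff₀ (pow_pos hLp n)]
      calc |c n| * (L n ^ k * ‖iteratedDeriv k (u n) (L n * x)‖)
          ≤ |c n| * (L n ^ k * M n) := by gcongr
        _ = L n ^ k * (|c n| * M n) := by ring
        _ ≤ L n ^ k * ((1/2) ^ n * L n) := by gcongr
        _ = (1/2) ^ n * (L n ^ k * L n) := by ring
        _ ≤ (1/2) ^ n * L n ^ n := by gcongr
    · gcongr
      exact hC n k _
  refine ⟨fun x => ∑' n, f n x, contDiff_tsum hf hv hfv, fun k => ?_⟩
  have hu0 : ∀ n k, iteratedDeriv k (u n) 0 = if k = n then (n.factorial : ℝ) else 0 := by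
    intro n k
    have e : u n =ᶠ[𝓝 0] fun s => s ^ n := by
      filter_upwards [χ.eventuallyEq_one] with s hs
      simp [u, hs]
    rw [e.iteratedDeriv_eq, iteratedDeriv_fun_pow_zero]
    split_ifs <;> simp_all
  have hs := congrFun (iteratedFDeriv_tsum hf hv hfv (k := k) le_top) 0
  have hsum : Summable fun n => iteratedFDeriv ℝ k (f n) 0 :=
    Summable.of_norm_bounded (hv k le_top) fun n => hfv k n 0 le_top
  rw [iteratedDeriv, hs, ContinuousMultilinearMap.tsum_eval hsum]
  have : ∀ n, (iteratedFDeriv ℝ k (f n) 0) (fun _ => 1) =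
      if n = k then (k.factorial : ℝ) * c k else 0 := by
    intro n
    have := hfd n k 0
    rw [iteratedDeriv] at this
    rw [this, mul_zero, hu0]
    have hLp : L n ≠ 0 := by have := hL1 n; positivity
    by_cases hkn : k = n
    · subst hkn; simp; field_simp
    · simp [hkn, Ne.symm hkn]
  simp [this]

lemma aux_one_dim (m : ℕ) (g : ℝ → ℝ) (hg : ContDiff ℝ (⊤ : ℕ∞) g)
    (h : ∀ j, (¬ ∃ i, j = m + 2 * i) → iteratedDeriv j g 0 = 0) :
    ∃ φ : ℝ → ℝ, ContDiff ℝ (⊤ : ℕ∞) φ ∧ ∀ t, 0 < t → g t = t ^ m * φ (t ^ 2) := by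
  obtain ⟨ψ, hψ, hψ'⟩ := aux_borel fun i => iteratedDeriv (m + 2 * i) g 0 / (m + 2 * i).factorial
  set r : ℝ → ℝ := fun t => g t - t ^ m * ψ (t ^ 2) with hrdef
  have hr : ContDiff ℝ (⊤ : ℕ∞) r :=
    hg.sub ((contDiff_id.pow m).mul (hψ.comp (contDiff_id.pow 2)))
  have hO : ∀ N : ℕ, r =o[𝓝 0] fun x => x ^ N := by
    intro N
    have t1 := aux_taylor g hg (m + 2 * N)
    have tsq : Tendsto (fun t : ℝ => t ^ 2) (𝓝 0) (𝓝 0) := by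
      have : Continuous fun t : ℝ => t ^ 2 := by fun_prop
      simpa using this.tendsto 0
    have t2 := (isBigO_refl (fun t : ℝ => t ^ m) (𝓝 0)).mul_isLittleO
      ((aux_taylor ψ hψ N).comp_tendsto tsq)
    have e2 : (fun x : ℝ => x ^ m * ((fun x => x ^ N) ∘ fun t => t ^ 2) x) =
        fun x => x ^ (m + 2 * N) := by
      ext x; simp [pow_add, pow_mul]
    rw [e2] at t2
    have t3 := t1.sub t2
    have t4 : r =o[𝓝 0] fun x => x ^ (m + 2 * N) := by
      refine t3.congr_left fun x => ?_
      have es : ∑ k ∈ Finset.range (m + 2 * N + 1),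
            iteratedDeriv k g 0 / (k.factorial : ℝ) * x ^ k =
          ∑ i ∈ Finset.range (N + 1), iteratedDeriv (m + 2 * i) g 0 /
            ((m + 2 * i).factorial : ℝ) * x ^ (m + 2 * i) := by
        rw [← Finset.sum_image (s := Finset.range (N + 1)) (g := fun i => m + 2 * i)
          (f := fun k => iteratedDeriv k g 0 / (k.factorial : ℝ) * x ^ k)]
        · symm
          apply Finset.sum_subset
          · intro k hk
            simp only [Finset.mem_image, Finset.mem_range] at hk ⊢
            obtain ⟨i, hi, rfl⟩ := hk
            omega
          · intro k hk hk'
            rw [h k]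
            · simp
            · rintro ⟨i, rfl⟩
              simp only [Finset.mem_image, Finset.mem_range] at hk hk'
              exact hk' ⟨i, by omega, rfl⟩
        · intro i _ j _ hij
          simp only at hij
          omega
      simp only [Function.comp, es, hrdef, hψ']
      rw [mul_sub, Finset.mul_sum]
      have : ∀ i : ℕ, x ^ m * ((i.factorial : ℝ) * (iteratedDeriv (m + 2 * i) g 0 /
          ((m + 2 * i).factorial : ℝ)) / (i.factorial : ℝ) * (x ^ 2) ^ i) =
          iteratedDeriv (m + 2 * i) g 0 / ((m + 2 * i).factorial : ℝ) * x ^ (m + 2 * i) := by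
        intro i
        have : (i.factorial : ℝ) ≠ 0 := by exact_mod_cast i.factorial_ne_zero
        rw [mul_div_cancel_left₀ _ this, pow_add, pow_mul]; ring
      simp only [this]
      ring
    refine t4.trans_isBigO ?_
    have : (fun x : ℝ => x ^ (m + 2 * N)) = fun x => x ^ (m + N) * x ^ N := by
      ext x; ring
    rw [this]
    have hb : (fun x : ℝ => x ^ (m + N)) =O[𝓝 0] fun _ => (1:ℝ) :=
      (by fun_prop : Continuous fun x : ℝ => x ^ (m + N)).continuousAt.isBigO_one ℝ
    simpa using hb.mul (isBigO_refl (fun x : ℝ => x ^ N) (𝓝 0))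
  have hflat := aux_flat_of_isLittleO r hr hO
  refine ⟨fun s => ψ s + r (√s) / (√s) ^ m, hψ.add ?_, ?_⟩
  · exact contDiff_infty.2 fun n => aux_flat_sqrt n m r hr hflat
  · intro t ht
    simp only [Real.sqrt_sq ht.le, hrdef]
    field_simp
    ring

lemma aux_expc (ψ : ℝ) : Complex.exp (ψ * Complex.I) = Real.cos ψ + Real.sin ψ * Complex.I := by
  rw [Complex.exp_mul_I, Complex.ofReal_cos, Complex.ofReal_sin]

lemma aux_fderiv_equiv (m : ℕ) (f : ℂ → ℂ) (hf : ContDiff ℝ (⊤ : ℕ∞) f)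
    (h : ∀ (ψ : ℝ) (z : ℂ), f (Complex.exp (ψ * Complex.I) * z) =
      Complex.exp (ψ * Complex.I) ^ m * f z) (ψ : ℝ) (z w : ℂ) :
    fderiv ℝ f (Complex.exp (ψ * Complex.I) * z) (Complex.exp (ψ * Complex.I) * w) =
      Complex.exp (ψ * Complex.I) ^ m * fderiv ℝ f z w := by
  set e := Complex.exp (ψ * Complex.I)
  have hd : Differentiable ℝ f := hf.differentiable (by simp)
  have h1 : HasFDerivAt (fun z => f (e * z))
      ((fderiv ℝ f (e * z)).comp (ContinuousLinearMap.mul ℝ ℂ e)) z :=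
    (hd (e * z)).hasFDerivAt.comp z (ContinuousLinearMap.mul ℝ ℂ e).hasFDerivAt
  have h2 : HasFDerivAt (fun z => f (e * z)) (e ^ m • fderiv ℝ f z) z := by
    rw [funext fun z => h ψ z]
    exact (hd z).hasFDerivAt.const_mul (e ^ m)
  have := congrArg (fun L : ℂ →L[ℝ] ℂ => L w) (h1.unique h2)
  simpa using this

lemma aux_fderiv_lin (L : ℂ →L[ℝ] ℂ) (x y : ℝ) : L (x + y * Complex.I) =
    x * L 1 + y * L Complex.I := by
  have : (x + y * Complex.I : ℂ) = x • (1:ℂ) + y • Complex.I := by simp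
  rw [this, map_add, map_smul, map_smul]; simp

lemma aux_vanish (j : ℕ) : ∀ (m : ℕ) (f : ℂ → ℂ), ContDiff ℝ (⊤ : ℕ∞) f →
    (∀ (ψ : ℝ) (z : ℂ), f (Complex.exp (ψ * Complex.I) * z) =
      Complex.exp (ψ * Complex.I) ^ m * f z) → j < m →
    iteratedDeriv j (fun t : ℝ => f t) 0 = 0 := by
  induction j with
  | zero =>
    intro m f hf h hm
    have h1 := h (Real.pi / m) 0
    have hm' : (m : ℂ) ≠ 0 := by exact_mod_cast hm.ne'
    have h2 : Complex.exp (((Real.pi / m : ℝ) : ℂ) * Complex.I) ^ m = -1 := by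
      rw [← Complex.exp_nat_mul, ← Complex.exp_pi_mul_I]
      congr 1
      push_cast
      field_simp
    rw [h2, mul_zero] at h1
    simp only [iteratedDeriv_zero, Complex.ofReal_zero]
    have h3 : 2 * f 0 = 0 := by linear_combination h1
    simpa using h3
  | succ j ih =>
    intro m f hf h hm
    obtain ⟨m, rfl⟩ : ∃ k, m = k + 1 := ⟨m - 1, by omega⟩
    have hd : Differentiable ℝ f := hf.differentiable (by simp)
    have hD : ∀ w : ℂ, ContDiff ℝ (⊤ : ℕ∞) fun z => fderiv ℝ f z w := fun w =>
      (hf.fderiv_right (m := (⊤ : ℕ∞)) (by simp)).clm_apply contDiff_const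
    let P : ℂ → ℂ := fun z => (fderiv ℝ f z 1 - Complex.I * fderiv ℝ f z Complex.I) / 2
    let Q : ℂ → ℂ := fun z => (fderiv ℝ f z 1 + Complex.I * fderiv ℝ f z Complex.I) / 2
    have hP : ContDiff ℝ (⊤ : ℕ∞) P := ((hD 1).sub (contDiff_const.mul (hD _))).div_const 2
    have hQ : ContDiff ℝ (⊤ : ℕ∞) Q := ((hD 1).add (contDiff_const.mul (hD _))).div_const 2
    have hE := aux_fderiv_equiv (m + 1) f hf h
    have hcs : ∀ ψ : ℝ, (Real.cos ψ : ℂ) ^ 2 + (Real.sin ψ : ℂ) ^ 2 = 1 := fun ψ => by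
      exact_mod_cast Real.cos_sq_add_sin_sq ψ
    -- values of the rotated derivative
    have v1 : ∀ (ψ : ℝ) (z : ℂ), fderiv ℝ f (Complex.exp (ψ * Complex.I) * z) 1 =
        Complex.exp (ψ * Complex.I) ^ (m + 1) *
          (Real.cos ψ * fderiv ℝ f z 1 - Real.sin ψ * fderiv ℝ f z Complex.I) := by
      intro ψ z
      have e1 := hE ψ z ((Real.cos ψ : ℝ) + ((-Real.sin ψ : ℝ) : ℂ) * Complex.I)
      have e2 : Complex.exp (ψ * Complex.I) *
          ((Real.cos ψ : ℝ) + ((-Real.sin ψ : ℝ) : ℂ) * Complex.I) = 1 := by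
        rw [aux_expc, ← hcs ψ]; push_cast
        linear_combination (-(Complex.sin ψ) ^ 2) * Complex.I_sq
      rw [e2, aux_fderiv_lin] at e1
      rw [e1]; push_cast; ring
    have v2 : ∀ (ψ : ℝ) (z : ℂ), fderiv ℝ f (Complex.exp (ψ * Complex.I) * z) Complex.I =
        Complex.exp (ψ * Complex.I) ^ (m + 1) *
          (Real.sin ψ * fderiv ℝ f z 1 + Real.cos ψ * fderiv ℝ f z Complex.I) := by
      intro ψ z
      have e1 := hE ψ z ((Real.sin ψ : ℝ) + (Real.cos ψ : ℂ) * Complex.I)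
      have e2 : Complex.exp (ψ * Complex.I) *
          ((Real.sin ψ : ℝ) + (Real.cos ψ : ℂ) * Complex.I) = Complex.I := by
        rw [aux_expc]
        linear_combination Complex.I * hcs ψ + Real.sin ψ * Real.cos ψ * Complex.I_sq
      rw [e2, aux_fderiv_lin] at e1
      exact e1
    have hPe : ∀ (ψ : ℝ) (z : ℂ), P (Complex.exp (ψ * Complex.I) * z) =
        Complex.exp (ψ * Complex.I) ^ m * P z := by
      intro ψ z
      have e3 : Complex.exp (ψ * Complex.I) * (Real.cos ψ - Real.sin ψ * Complex.I) = 1 := by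
        rw [aux_expc, ← hcs ψ]
        linear_combination (-(Real.sin ψ : ℂ) ^ 2) * Complex.I_sq
      simp only [P, v1, v2, pow_succ]
      linear_combination Complex.exp (ψ * Complex.I) ^ m *
        (fderiv ℝ f z 1 - Complex.I * fderiv ℝ f z Complex.I) / 2 * e3
        - Complex.exp (ψ * Complex.I) ^ m * Complex.exp (ψ * Complex.I) * Real.sin ψ *
          fderiv ℝ f z Complex.I / 2 * Complex.I_sq
    have hQe : ∀ (ψ : ℝ) (z : ℂ), Q (Complex.exp (ψ * Complex.I) * z) =
        Complex.exp (ψ * Complex.I) ^ (m + 2) * Q z := by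
      intro ψ z
      have e3 := aux_expc ψ
      simp only [Q, v1, v2]
      rw [pow_succ _ (m + 1)]
      linear_combination (-Complex.exp (ψ * Complex.I) ^ (m + 1) *
        (fderiv ℝ f z 1 + Complex.I * fderiv ℝ f z Complex.I) / 2) * e3
        - Complex.exp (ψ * Complex.I) ^ (m + 1) * Real.sin ψ *
          fderiv ℝ f z Complex.I / 2 * Complex.I_sq
    have hof : ContDiff ℝ (⊤ : ℕ∞) (fun t : ℝ => (t : ℂ)) := Complex.ofRealCLM.contDiff
    have hder : deriv (fun t : ℝ => f t) = fun t : ℝ => P t + Q t := by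
      ext t
      have : HasDerivAt (fun t : ℝ => f t) (fderiv ℝ f t 1) t :=
        (hd t).hasFDerivAt.comp_hasDerivAt t Complex.ofRealCLM.hasDerivAt
      rw [this.deriv]; simp only [P, Q]; ring
    have hle : ((j : ℕ) : WithTop ℕ∞) ≤ ((⊤ : ℕ∞) : WithTop ℕ∞) := by exact_mod_cast le_top
    rw [iteratedDeriv_succ', hder, iteratedDeriv_fun_add
      (f := fun t : ℝ => P t) (g := fun t : ℝ => Q t)
      ((hP.comp hof).of_le hle).contDiffAt ((hQ.comp hof).of_le hle).contDiffAt,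
      ih m P hP hPe (by omega), ih (m + 2) Q hQ hQe (by omega), add_zero]

lemma aux_iter_clm (L : ℂ →L[ℝ] ℝ) (g : ℝ → ℂ) (hg : ContDiff ℝ (⊤ : ℕ∞) g) (j : ℕ) (x : ℝ) :
    iteratedDeriv j (fun t => L (g t)) x = L (iteratedDeriv j g x) := by
  have := L.iteratedFDeriv_comp_left (f := g) (x := x) (n := ((⊤ : ℕ∞) : WithTop ℕ∞)) hg.contDiffAt
    (i := j) (by exact_mod_cast le_top)
  simp only [iteratedDeriv]
  exact congrArg (fun M => M (fun _ => (1:ℝ))) this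

lemma aux_complex (m : ℕ) (f : ℂ → ℂ) (hf : ContDiff ℝ (⊤ : ℕ∞) f)
    (h : ∀ (ψ : ℝ) (z : ℂ), f (Complex.exp (ψ * Complex.I) * z) =
      Complex.exp (ψ * Complex.I) ^ m * f z) (L : ℂ →L[ℝ] ℝ) :
    ∃ φ : ℝ → ℝ, ContDiff ℝ (⊤ : ℕ∞) φ ∧ ∀ t : ℝ, 0 < t → L (f t) = t ^ m * φ (t ^ 2) := by
  have hof : ContDiff ℝ (⊤ : ℕ∞) (fun t : ℝ => (t : ℂ)) := Complex.ofRealCLM.contDiff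
  have hg : ContDiff ℝ (⊤ : ℕ∞) (fun t : ℝ => f t) := hf.comp hof
  refine aux_one_dim m (fun t : ℝ => L (f t)) (L.contDiff.comp hg) fun j hj => ?_
  rw [aux_iter_clm L (fun t : ℝ => f t) hg]
  rcases lt_or_ge j m with hjm | hjm
  · rw [aux_vanish j m f hf h hjm, map_zero]
  · obtain ⟨k, rfl⟩ := Nat.exists_eq_add_of_le hjm
    have hk : Odd k := by
      rw [← Nat.not_even_iff_odd]
      rintro ⟨i, rfl⟩
      exact hj ⟨i, by omega⟩
    have e1 : (fun t : ℝ => f ((-t : ℝ) : ℂ)) = ((-1 : ℝ) ^ m) • fun t : ℝ => f t := by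
      ext t
      have := h Real.pi t
      rw [Complex.exp_pi_mul_I] at this
      simp only [Pi.smul_apply, Complex.real_smul]
      push_cast
      rw [← this]; congr 1; ring
    have e2 := iteratedDeriv_comp_neg (m + k) (fun t : ℝ => f t) 0
    rw [e1, iteratedDeriv_const_smul_field, neg_zero, pow_add, hk.neg_one_pow] at e2
    have e3 : iteratedDeriv (m + k) (fun t : ℝ => f t) 0 = 0 := by
      rcases neg_one_pow_eq_or ℝ m with e | e <;> rw [e] at e2 <;> simp at e2 
      · have := self_eq_neg.1 e2; exact this
      · have := self_eq_neg.1 e2.symm; exact this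
    rw [e3, map_zero]

lemma aux_entries (α : ℝ) (M : Matrix (Fin 3) (Fin 3) ℝ) (hM : M.IsSymm) :
    let N := blockRot3 α * M * (blockRot3 α)ᵀ
    let e := Complex.exp (α * Complex.I)
    ((N 0 0 + N 1 1) / 2 = (M 0 0 + M 1 1) / 2) ∧
    ((((N 0 0 - N 1 1) / 2 : ℝ) : ℂ) + (N 0 1 : ℝ) * Complex.I =
      e ^ 2 * ((((M 0 0 - M 1 1) / 2 : ℝ) : ℂ) + (M 0 1 : ℝ) * Complex.I)) ∧
    ((N 0 2 : ℂ) + (N 1 2 : ℝ) * Complex.I = e * ((M 0 2 : ℂ) + (M 1 2 : ℝ) * Complex.I)) ∧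
    N 2 2 = M 2 2 := by
  intro N e
  have h01 : M 1 0 = M 0 1 := hM.apply 0 1
  have h02 : M 2 0 = M 0 2 := hM.apply 0 2
  have h12 : M 2 1 = M 1 2 := hM.apply 1 2
  have he : e = Real.cos α + Real.sin α * Complex.I := aux_expc α
  have hcs := Real.cos_sq_add_sin_sq α
  have n00 : N 0 0 = Real.cos α ^ 2 * M 0 0 - 2 * Real.cos α * Real.sin α * M 0 1
      + Real.sin α ^ 2 * M 1 1 := by
    simp only [N, Matrix.mul_apply, Fin.sum_univ_three, Matrix.transpose_apply]; simp [blockRot3, h01]; ring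
  have n11 : N 1 1 = Real.sin α ^ 2 * M 0 0 + 2 * Real.cos α * Real.sin α * M 0 1
      + Real.cos α ^ 2 * M 1 1 := by
    simp only [N, Matrix.mul_apply, Fin.sum_univ_three, Matrix.transpose_apply]; simp [blockRot3, h01]; ring
  have n01 : N 0 1 = Real.cos α * Real.sin α * (M 0 0 - M 1 1)
      + (Real.cos α ^ 2 - Real.sin α ^ 2) * M 0 1 := by
    simp only [N, Matrix.mul_apply, Fin.sum_univ_three, Matrix.transpose_apply]; simp [blockRot3, h01]; ring
  have n02 : N 0 2 = Real.cos α * M 0 2 - Real.sin α * M 1 2 := by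
    simp only [N, Matrix.mul_apply, Fin.sum_univ_three, Matrix.transpose_apply]; simp [blockRot3]; ring
  have n12 : N 1 2 = Real.sin α * M 0 2 + Real.cos α * M 1 2 := by
    simp only [N, Matrix.mul_apply, Fin.sum_univ_three, Matrix.transpose_apply]; simp [blockRot3]
  have n22 : N 2 2 = M 2 2 := by
    simp only [N, Matrix.mul_apply, Fin.sum_univ_three, Matrix.transpose_apply]; simp [blockRot3]
  refine ⟨?_, ?_, ?_, n22⟩
  · rw [n00, n11]; linear_combination (M 0 0 + M 1 1) / 2 * hcs
  · rw [n00, n11, n01, he]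
    apply Complex.ext
    · simp [pow_two]; ring
    · simp [pow_two]; ring
  · rw [n02, n12, he]
    apply Complex.ext
    · simp
    · simp; ring

lemma aux_extend_equiv (m : ℕ) (f F : ℂ → ℂ) (hf : Continuous f) (hF : ∀ z, z ≠ 0 → f z = F z)
    (h : ∀ (ψ : ℝ) (z : ℂ), z ≠ 0 → F (Complex.exp (ψ * Complex.I) * z) =
      Complex.exp (ψ * Complex.I) ^ m * F z) (ψ : ℝ) (z : ℂ) :
    f (Complex.exp (ψ * Complex.I) * z) = Complex.exp (ψ * Complex.I) ^ m * f z := by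
  have := Continuous.ext_on (dense_compl_singleton (0:ℂ))
    (f := fun z => f (Complex.exp (ψ * Complex.I) * z))
    (g := fun z => Complex.exp (ψ * Complex.I) ^ m * f z) (by fun_prop) (by fun_prop) ?_
  · exact congrFun this z
  · intro z hz
    simp only
    rw [hF z hz, hF _ (mul_ne_zero (Complex.exp_ne_zero _) hz), h ψ z hz]

lemma aux_polar (m : ℕ) (F : ℂ → ℂ)
    (h : ∀ (ψ : ℝ) (z : ℂ), z ≠ 0 → F (Complex.exp (ψ * Complex.I) * z) =
      Complex.exp (ψ * Complex.I) ^ m * F z) (φ χ : ℝ → ℝ)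
    (hφ : ∀ t : ℝ, 0 < t → F t = (t : ℂ) ^ m * (φ (t ^ 2) + χ (t ^ 2) * Complex.I))
    (z : ℂ) (hz : z ≠ 0) :
    F z = z ^ m * (φ (Complex.normSq z) + χ (Complex.normSq z) * Complex.I) := by
  have e : Complex.exp (Complex.arg z * Complex.I) * (‖z‖ : ℝ) = z := by
    rw [mul_comm]; exact Complex.norm_mul_exp_arg_mul_I z
  have hp : 0 < ‖z‖ := norm_pos_iff.2 hz
  have h1 := h (Complex.arg z) (‖z‖ : ℝ) (by exact_mod_cast hp.ne')
  rw [e, hφ _ hp, ← mul_assoc, ← mul_pow, e] at h1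
  rw [h1, Complex.normSq_eq_norm_sq]

end Aux


theorem smooth_extension_iff_irreducible_and_trivial_module
    (a d : ℕ) (ha : 0 < a) (hd : 0 < d) (hdvd : a ∣ d)
    (G : ℂ → Matrix (Fin 3) (Fin 3) ℝ)
    (hsmooth : ∀ i j : Fin 3, ContDiffOn ℝ (⊤ : ℕ∞) (fun z => G z i j) {0}ᶜ)
    (hsymm : ∀ z : ℂ, z ≠ 0 → (G z).IsSymm)
    (hequiv : ∀ (θ : ℝ) (z : ℂ), z ≠ 0 →
      G (Complex.exp ((a * θ : ℝ) * Complex.I) * z) =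
        blockRot3 (d * θ) * G z * (blockRot3 (d * θ))ᵀ) :
    (∃ Ge : ℂ → Matrix (Fin 3) (Fin 3) ℝ,
        (∀ i j : Fin 3, ContDiff ℝ (⊤ : ℕ∞) fun z => Ge z i j) ∧
        ∀ z : ℂ, z ≠ 0 → Ge z = G z) ↔
      ∃ φ₁ φ₂ φ₃ φ₄ φ₅ φ₆ : ℝ → ℝ,
        ContDiff ℝ (⊤ : ℕ∞) φ₁ ∧ ContDiff ℝ (⊤ : ℕ∞) φ₂ ∧
        ContDiff ℝ (⊤ : ℕ∞) φ₃ ∧ ContDiff ℝ (⊤ : ℕ∞) φ₄ ∧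
        ContDiff ℝ (⊤ : ℕ∞) φ₅ ∧ ContDiff ℝ (⊤ : ℕ∞) φ₆ ∧
        ∀ t : ℝ, 0 < t →
          G (t : ℂ) 0 0 = φ₁ (t ^ 2) + t ^ (2 * (d / a)) * φ₂ (t ^ 2) ∧
          G (t : ℂ) 1 1 = φ₁ (t ^ 2) - t ^ (2 * (d / a)) * φ₂ (t ^ 2) ∧
          G (t : ℂ) 0 1 = t ^ (2 * (d / a)) * φ₃ (t ^ 2) ∧
          G (t : ℂ) 0 2 = t ^ (d / a) * φ₄ (t ^ 2) ∧
          G (t : ℂ) 1 2 = t ^ (d / a) * φ₅ (t ^ 2) ∧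
          G (t : ℂ) 2 2 = φ₆ (t ^ 2) := by
  set q := d / a with hq
  have haq : d = a * q := (Nat.mul_div_cancel' hdvd).symm
  have ha' : (a : ℝ) ≠ 0 := by exact_mod_cast ha.ne'
  have hexp : ∀ ψ : ℝ, Complex.exp (((d * (ψ / a) : ℝ) : ℂ) * Complex.I) =
      Complex.exp (ψ * Complex.I) ^ q := by
    intro ψ
    rw [← Complex.exp_nat_mul]
    congr 1
    have : (d * (ψ / a) : ℝ) = q * ψ := by rw [haq]; push_cast; field_simp
    rw [this]; push_cast; ring
  have hrot : ∀ (ψ : ℝ) (z : ℂ), z ≠ 0 → G (Complex.exp (ψ * Complex.I) * z) =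
      blockRot3 (d * (ψ / a)) * G z * (blockRot3 (d * (ψ / a)))ᵀ := by
    intro ψ z hz
    rw [← hequiv _ z hz, mul_div_cancel₀ _ ha']
  let T0 : Matrix (Fin 3) (Fin 3) ℝ → ℂ := fun M => (((M 0 0 + M 1 1) / 2 : ℝ) : ℂ)
  let T2 : Matrix (Fin 3) (Fin 3) ℝ → ℂ := fun M =>
    (((M 0 0 - M 1 1) / 2 : ℝ) : ℂ) + (M 0 1 : ℝ) * Complex.I
  let T1 : Matrix (Fin 3) (Fin 3) ℝ → ℂ := fun M => (M 0 2 : ℂ) + (M 1 2 : ℝ) * Complex.I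
  let T3 : Matrix (Fin 3) (Fin 3) ℝ → ℂ := fun M => (M 2 2 : ℂ)
  have r0 : ∀ (ψ : ℝ) (z : ℂ), z ≠ 0 → T0 (G (Complex.exp (ψ * Complex.I) * z)) =
      Complex.exp (ψ * Complex.I) ^ 0 * T0 (G z) := by
    intro ψ z hz
    rw [hrot ψ z hz, pow_zero, one_mul]
    exact congrArg Complex.ofReal (aux_entries (d * (ψ / a)) (G z) (hsymm z hz)).1
  have r2 : ∀ (ψ : ℝ) (z : ℂ), z ≠ 0 → T2 (G (Complex.exp (ψ * Complex.I) * z)) =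
      Complex.exp (ψ * Complex.I) ^ (2 * q) * T2 (G z) := by
    intro ψ z hz
    rw [hrot ψ z hz, mul_comm 2 q, pow_mul, ← hexp]
    exact (aux_entries (d * (ψ / a)) (G z) (hsymm z hz)).2.1
  have r1 : ∀ (ψ : ℝ) (z : ℂ), z ≠ 0 → T1 (G (Complex.exp (ψ * Complex.I) * z)) =
      Complex.exp (ψ * Complex.I) ^ q * T1 (G z) := by
    intro ψ z hz
    rw [hrot ψ z hz, ← hexp]
    exact (aux_entries (d * (ψ / a)) (G z) (hsymm z hz)).2.2.1
  have r3 : ∀ (ψ : ℝ) (z : ℂ), z ≠ 0 → T3 (G (Complex.exp (ψ * Complex.I) * z)) =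
      Complex.exp (ψ * Complex.I) ^ 0 * T3 (G z) := by
    intro ψ z hz
    rw [hrot ψ z hz, pow_zero, one_mul]
    exact congrArg Complex.ofReal (aux_entries (d * (ψ / a)) (G z) (hsymm z hz)).2.2.2
  have hofR : ContDiff ℝ (⊤ : ℕ∞) (fun t : ℝ => (t : ℂ)) := Complex.ofRealCLM.contDiff
  constructor
  · rintro ⟨Ge, hGe, hG⟩
    have s0 : ContDiff ℝ (⊤ : ℕ∞) fun z => T0 (Ge z) :=
      hofR.comp (((hGe 0 0).add (hGe 1 1)).div_const 2)
    have s2 : ContDiff ℝ (⊤ : ℕ∞) fun z => T2 (Ge z) :=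
      (hofR.comp (((hGe 0 0).sub (hGe 1 1)).div_const 2)).add
        ((hofR.comp (hGe 0 1)).mul contDiff_const)
    have s1 : ContDiff ℝ (⊤ : ℕ∞) fun z => T1 (Ge z) :=
      (hofR.comp (hGe 0 2)).add ((hofR.comp (hGe 1 2)).mul contDiff_const)
    have s3 : ContDiff ℝ (⊤ : ℕ∞) fun z => T3 (Ge z) := hofR.comp (hGe 2 2)
    have e0 := aux_extend_equiv 0 (fun z => T0 (Ge z)) (fun z => T0 (G z)) s0.continuous
      (fun z hz => by simp only [hG z hz]) r0
    have e2 := aux_extend_equiv (2 * q) (fun z => T2 (Ge z)) (fun z => T2 (G z)) s2.continuous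
      (fun z hz => by simp only [hG z hz]) r2
    have e1 := aux_extend_equiv q (fun z => T1 (Ge z)) (fun z => T1 (G z)) s1.continuous
      (fun z hz => by simp only [hG z hz]) r1
    have e3 := aux_extend_equiv 0 (fun z => T3 (Ge z)) (fun z => T3 (G z)) s3.continuous
      (fun z hz => by simp only [hG z hz]) r3
    obtain ⟨φ₁, h1, k1⟩ := aux_complex 0 _ s0 e0 Complex.reCLM
    obtain ⟨φ₂, h2, k2⟩ := aux_complex _ _ s2 e2 Complex.reCLM
    obtain ⟨φ₃, h3, k3⟩ := aux_complex _ _ s2 e2 Complex.imCLM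
    obtain ⟨φ₄, h4, k4⟩ := aux_complex _ _ s1 e1 Complex.reCLM
    obtain ⟨φ₅, h5, k5⟩ := aux_complex _ _ s1 e1 Complex.imCLM
    obtain ⟨φ₆, h6, k6⟩ := aux_complex 0 _ s3 e3 Complex.reCLM
    refine ⟨φ₁, φ₂, φ₃, φ₄, φ₅, φ₆, h1, h2, h3, h4, h5, h6, fun t ht => ?_⟩
    have hGt := hG (t : ℂ) (by exact_mod_cast ht.ne')
    replace k1 := k1 t ht
    replace k2 := k2 t ht
    replace k3 := k3 t ht
    replace k4 := k4 t ht
    replace k5 := k5 t ht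
    replace k6 := k6 t ht
    rw [hGt] at k1 k2 k3 k4 k5 k6
    simp only [T0, T1, T2, T3, Complex.reCLM_apply, Complex.imCLM_apply, Complex.add_re,
      Complex.add_im, Complex.ofReal_re, Complex.ofReal_im, Complex.re_ofReal_mul,
      Complex.im_ofReal_mul, Complex.I_re, Complex.I_im, mul_zero, mul_one, add_zero, zero_add,
      pow_zero, one_mul] at k1 k2 k3 k4 k5 k6
    refine ⟨?_, ?_, k3, k4, k5, k6⟩ <;> linarith
  · rintro ⟨φ₁, φ₂, φ₃, φ₄, φ₅, φ₆, h1, h2, h3, h4, h5, h6, k⟩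
    have hns : ContDiff ℝ (⊤ : ℕ∞) fun z : ℂ => Complex.normSq z := by
      have : (fun z : ℂ => Complex.normSq z) = fun z => z.re * z.re + z.im * z.im := by
        ext z; exact Complex.normSq_apply z
      rw [this]
      exact (Complex.reCLM.contDiff.mul Complex.reCLM.contDiff).add
        (Complex.imCLM.contDiff.mul Complex.imCLM.contDiff)
    let K2 : ℂ → ℂ := fun z => z ^ (2 * q) *
      (φ₂ (Complex.normSq z) + φ₃ (Complex.normSq z) * Complex.I)
    let K1 : ℂ → ℂ := fun z => z ^ q *
      (φ₄ (Complex.normSq z) + φ₅ (Complex.normSq z) * Complex.I)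
    have c1 : ContDiff ℝ (⊤ : ℕ∞) K1 := (contDiff_id.pow q).mul
      ((hofR.comp (h4.comp hns)).add ((hofR.comp (h5.comp hns)).mul contDiff_const))
    have c2 : ContDiff ℝ (⊤ : ℕ∞) K2 := (contDiff_id.pow (2 * q)).mul
      ((hofR.comp (h2.comp hns)).add ((hofR.comp (h3.comp hns)).mul contDiff_const))
    have c1r : ContDiff ℝ (⊤ : ℕ∞) fun z => (K1 z).re := Complex.reCLM.contDiff.comp c1
    have c1i : ContDiff ℝ (⊤ : ℕ∞) fun z => (K1 z).im := Complex.imCLM.contDiff.comp c1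
    have c2r : ContDiff ℝ (⊤ : ℕ∞) fun z => (K2 z).re := Complex.reCLM.contDiff.comp c2
    have c2i : ContDiff ℝ (⊤ : ℕ∞) fun z => (K2 z).im := Complex.imCLM.contDiff.comp c2
    have c0 : ContDiff ℝ (⊤ : ℕ∞) fun z : ℂ => φ₁ (Complex.normSq z) := h1.comp hns
    have c6 : ContDiff ℝ (⊤ : ℕ∞) fun z : ℂ => φ₆ (Complex.normSq z) := h6.comp hns
    refine ⟨fun z => !![φ₁ (Complex.normSq z) + (K2 z).re, (K2 z).im, (K1 z).re;
      (K2 z).im, φ₁ (Complex.normSq z) - (K2 z).re, (K1 z).im;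
      (K1 z).re, (K1 z).im, φ₆ (Complex.normSq z)], ?_, ?_⟩
    · intro i j
      fin_cases i <;> fin_cases j
      · exact c0.add c2r
      · exact c2i
      · exact c1r
      · exact c2i
      · exact c0.sub c2r
      · exact c1i
      · exact c1r
      · exact c1i
      · exact c6
    · intro z hz
      have p0 := aux_polar 0 (fun z => T0 (G z)) r0 φ₁ (fun _ => 0) (fun t ht => by
        obtain ⟨a1, a2, -⟩ := k t ht
        simp only [T0, a1, a2]; push_cast; ring) z hz
      have p2 := aux_polar (2 * q) (fun z => T2 (G z)) r2 φ₂ φ₃ (fun t ht => by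
        obtain ⟨a1, a2, a3, -⟩ := k t ht
        simp only [T2, a1, a2, a3]; push_cast; ring) z hz
      have p1 := aux_polar q (fun z => T1 (G z)) r1 φ₄ φ₅ (fun t ht => by
        obtain ⟨-, -, -, a4, a5, -⟩ := k t ht
        simp only [T1, a4, a5]; push_cast; ring) z hz
      have p3 := aux_polar 0 (fun z => T3 (G z)) r3 φ₆ (fun _ => 0) (fun t ht => by
        obtain ⟨-, -, -, -, -, a6⟩ := k t ht
        simp only [T3, a6]; push_cast; ring) z hz
      have q1 : T1 (G z) = K1 z := p1
      have q2 : T2 (G z) = K2 z := p2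
      have q0 : (G z 0 0 + G z 1 1) / 2 = φ₁ (Complex.normSq z) := by
        have : (((G z 0 0 + G z 1 1) / 2 : ℝ) : ℂ) = (φ₁ (Complex.normSq z) : ℝ) := by
          simpa [T0] using p0
        exact_mod_cast this
      have q3 : G z 2 2 = φ₆ (Complex.normSq z) := by
        have : ((G z 2 2 : ℝ) : ℂ) = (φ₆ (Complex.normSq z) : ℝ) := by
          simpa [T3] using p3
        exact_mod_cast this
      have q1r : G z 0 2 = (K1 z).re := by rw [← q1]; simp [T1]
      have q1i : G z 1 2 = (K1 z).im := by rw [← q1]; simp [T1]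
      have q2r : (G z 0 0 - G z 1 1) / 2 = (K2 z).re := by
        rw [← q2]
        simp only [T2, Complex.add_re, Complex.ofReal_re, Complex.re_ofReal_mul, Complex.I_re,
          mul_zero, add_zero]
      have q2i : G z 0 1 = (K2 z).im := by
        rw [← q2]
        simp only [T2, Complex.add_im, Complex.ofReal_im, Complex.im_ofReal_mul, Complex.I_im,
          mul_one, zero_add]
      have h01 : G z 1 0 = G z 0 1 := (hsymm z hz).apply 0 1
      have h02 : G z 2 0 = G z 0 2 := (hsymm z hz).apply 0 2
      have h12 : G z 2 1 = G z 1 2 := (hsymm z hz).apply 1 2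
      ext i j
      fin_cases i <;> fin_cases j
      · change φ₁ (Complex.normSq z) + (K2 z).re = G z 0 0
        linarith
      · exact q2i.symm
      · exact q1r.symm
      · exact q2i.symm.trans h01.symm
      · change φ₁ (Complex.normSq z) - (K2 z).re = G z 1 1
        linarith
      · exact q1i.symm
      · exact q1r.symm.trans h02.symm
      · exact q1i.symm.trans h12.symm
      · exact q3.symm
end

section
/- Let a be a positive integer and let B(θ) be the 3×3 block-diagonal matrix diag(R(aθ), 1). Let G : ℂ \ {0} → M₃(ℝ) be a C^∞ function taking symmetric matrix values, satisfying G(e^{iaθ}z) = B(θ)·G(z)·B(θ)ᵀ for all θ ∈ ℝ and z ∈ ℂ \ {0}, and such that for all real t > 0: G(t)₁₁ = G(t)₂₂ = 1, G(t)₁₂ = 0 and G(t)₁₃ = 0. Then G extends to a C^∞ function on all of ℂ if and only if there exist C^∞ functions φ, ψ : ℝ → ℝ such that G(t)₂₃ = t·φ(t²) and G(t)₃₃ = ψ(t²) for all real t > 0. -/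
open Matrix

open Asymptotics Filter Topology in
/-- Smooth functions vanishing to infinite order at the origin. -/
def FlatAtZero (h : ℝ → ℝ) : Prop :=
  ContDiff ℝ (⊤ : ℕ∞) h ∧ ∀ n : ℕ, h =O[𝓝 0] (fun x : ℝ => x ^ n)

open Asymptotics Filter Topology in
lemma FlatAtZero.iter {h : ℝ → ℝ} (hh : FlatAtZero h) (n : ℕ) : iteratedDeriv n h 0 = 0 := by
  induction n using Nat.strong_induction_on with
  | _ n ih =>
    have h1 := taylor_isLittleO_univ (f := h) (x₀ := 0) (n := n)
      (hh.1.of_le (by exact_mod_cast le_top))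
    have h2 : ∀ x, taylorWithinEval h n Set.univ 0 x
        = (((n.factorial : ℝ)⁻¹) * iteratedDeriv n h 0) * x ^ n := by
      intro x
      rw [taylor_within_apply, Finset.sum_range_succ, Finset.sum_eq_zero]
      · simp [iteratedDerivWithin_univ]; ring
      · intro k hk
        rw [iteratedDerivWithin_univ, ih k (Finset.mem_range.1 hk)]; simp
    simp only [h2, sub_zero] at h1
    have h3 : h =o[𝓝 0] (fun x : ℝ => x ^ n) :=
      (hh.2 (n+1)).trans_isLittleO (isLittleO_pow_pow (Nat.lt_succ_self n))
    have h4 := h3.sub h1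
    simp only [sub_sub_cancel] at h4
    have h5 := (h4.tendsto_div_nhds_zero).mono_left (nhdsWithin_le_nhds (s := {0}ᶜ))
    have h6 : Tendsto (fun _ : ℝ => ((n.factorial : ℝ)⁻¹) * iteratedDeriv n h 0) (𝓝[≠] 0) (𝓝 0) := by
      refine h5.congr' ?_
      filter_upwards [self_mem_nhdsWithin] with x hx
      have : x ^ n ≠ 0 := pow_ne_zero _ hx
      field_simp
    have h7 := tendsto_nhds_unique h6 tendsto_const_nhds
    have : (n.factorial : ℝ)⁻¹ ≠ 0 := by positivity
    simpa [this] using h7.symm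

open Asymptotics Filter Topology in
lemma flatAtZero_of_iter {h : ℝ → ℝ} (hs : ContDiff ℝ (⊤ : ℕ∞) h)
    (hh : ∀ n, iteratedDeriv n h 0 = 0) : FlatAtZero h := by
  refine ⟨hs, fun n => ?_⟩
  have h1 := taylor_isLittleO_univ (f := h) (x₀ := 0) (n := n)
      (hs.of_le (by exact_mod_cast le_top))
  have h2 : ∀ x, taylorWithinEval h n Set.univ 0 x = 0 := by
    intro x
    rw [taylor_within_apply, Finset.sum_eq_zero]
    intro k _
    rw [iteratedDerivWithin_univ, hh]; simp
  simp only [h2, sub_zero] at h1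
  exact h1.isBigO

lemma FlatAtZero.deriv {h : ℝ → ℝ} (hh : FlatAtZero h) : FlatAtZero (deriv h) := by
  refine flatAtZero_of_iter ?_ fun n => ?_
  · exact ((contDiff_infty_iff_deriv (𝕜 := ℝ)).1 hh.1).2
  · rw [← iteratedDeriv_succ']; exact hh.iter _

open Asymptotics Filter Topology in
lemma FlatAtZero.comp_neg {h : ℝ → ℝ} (hh : FlatAtZero h) : FlatAtZero (fun x => h (-x)) := by
  refine flatAtZero_of_iter (hh.1.comp contDiff_neg) fun n => ?_
  rw [iteratedDeriv_comp_neg]; simp [hh.iter]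

/-- `x ↦ √x ^ (-m) * h (√x)` on the positive half line, zero elsewhere. -/
noncomputable def sqrtLift (m : ℕ) (h : ℝ → ℝ) (x : ℝ) : ℝ :=
  if 0 < x then (√x ^ m)⁻¹ * h (√x) else 0

open Asymptotics Filter Topology in
lemma sqrtLift_hasDerivAt {h : ℝ → ℝ} (hh : FlatAtZero h) (m : ℕ) (x : ℝ) :
    HasDerivAt (sqrtLift m h)
      (-(m / 2 : ℝ) * sqrtLift (m + 2) h x + (1 / 2) * sqrtLift (m + 1) (deriv h) x) x := by
  rcases lt_trichotomy x 0 with hx | hx | hx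
  · have h0 : sqrtLift m h =ᶠ[𝓝 x] fun _ => 0 := by
      filter_upwards [gt_mem_nhds hx] with y hy
      simp [sqrtLift, not_lt.2 hy.le]
    have : HasDerivAt (sqrtLift m h) 0 x := (hasDerivAt_const x (0:ℝ)).congr_of_eventuallyEq h0
    simpa [sqrtLift, not_lt.2 hx.le] using this
  · subst hx
    have h1 : HasDerivAt (sqrtLift m h) 0 0 := by
      rw [hasDerivAt_iff_isLittleO]
      simp only [sqrtLift, lt_irrefl, if_false, sub_zero, smul_zero]
      have h2 : (fun x : ℝ => if 0 < x then (√x ^ m)⁻¹ * h (√x) else 0) =O[𝓝 0]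
          fun x : ℝ => x ^ 2 := by
        obtain ⟨C, hC⟩ := (hh.2 (m + 4)).bound
        refine IsBigO.of_bound C ?_
        have hs : Tendsto Real.sqrt (𝓝 0) (𝓝 0) := by
          simpa using Real.continuous_sqrt.tendsto 0
        have hC0 := hs.eventually hC
        filter_upwards [hC0] with y hy
        split_ifs with hy0
        · have hp : 0 < √y := Real.sqrt_pos.2 hy0
          have e : y ^ 2 = √y ^ 4 := by
            nth_rewrite 1 [← Real.sq_sqrt hy0.le]; ring
          rw [e, norm_mul, norm_inv, norm_pow, norm_pow, inv_mul_le_iff₀ (pow_pos (norm_pos_iff.2 hp.ne') m)]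
          rw [norm_pow] at hy
          calc _ ≤ _ := hy
            _ = _ := by ring
        · rw [norm_pow, norm_zero]
          by_cases hyz : y = 0
          · simp [hyz]
          have hy1 : 0 > y := lt_of_le_of_ne (not_lt.1 hy0) hyz
          exact mul_nonneg (by
            by_contra hc
            push Not at hc
            have hev := hC.filter_mono (nhdsWithin_le_nhds (s := {0}ᶜ))
            obtain ⟨z, hz, hz0⟩ := (hev.and self_mem_nhdsWithin).exists
            have : 0 < ‖z ^ (m+4)‖ := norm_pos_iff.2 (pow_ne_zero _ hz0)
            have := norm_nonneg (h z)
            nlinarith) (by positivity)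
      exact h2.trans_isLittleO (by simpa using isLittleO_pow_pow (𝕜 := ℝ) (show 1 < 2 by norm_num))
    simpa [sqrtLift] using h1
  · have hp : 0 < √x := Real.sqrt_pos.2 hx
    have h0 : sqrtLift m h =ᶠ[𝓝 x] fun y => (√y ^ m)⁻¹ * h (√y) := by
      filter_upwards [lt_mem_nhds hx] with y hy
      simp [sqrtLift, hy]
    have hs := Real.hasDerivAt_sqrt hx.ne'
    have hd : HasDerivAt h (deriv h √x) √x :=
      (hh.1.differentiable (by simp)).differentiableAt.hasDerivAt
    have h1 := ((hs.pow m).inv (pow_ne_zero _ hp.ne')).mul (hd.comp x hs)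
    refine (h1.congr_of_eventuallyEq h0).congr_deriv ?_
    simp only [sqrtLift, hx, if_true, Function.comp, Pi.pow_apply, Pi.inv_apply]
    rcases m with _ | m
    · simp; field_simp
    · simp only [Nat.add_sub_cancel]
      push_cast
      field_simp
      ring

lemma sqrtLift_contDiff_nat (n : ℕ) : ∀ (m : ℕ) (h : ℝ → ℝ), FlatAtZero h →
    ContDiff ℝ n (sqrtLift m h) := by
  induction n with
  | zero =>
    intro m h hh
    exact contDiff_zero.2 (continuous_iff_continuousAt.2 fun x =>
      (sqrtLift_hasDerivAt hh m x).continuousAt)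
  | succ n ih =>
    intro m h hh
    have hd : deriv (sqrtLift m h) = fun x => 
      (-(m / 2 : ℝ) * sqrtLift (m + 2) h x + (1 / 2) * sqrtLift (m + 1) (deriv h) x) :=
      funext fun x => (sqrtLift_hasDerivAt hh m x).deriv
    push_cast
    rw [contDiff_succ_iff_deriv]
    refine ⟨fun x => (sqrtLift_hasDerivAt hh m x).differentiableAt, by simp, ?_⟩
    rw [hd]
    exact (contDiff_const.mul (ih _ _ hh)).add (contDiff_const.mul (ih _ _ hh.deriv))

lemma sqrtLift_contDiff {h : ℝ → ℝ} (hh : FlatAtZero h) (m : ℕ) :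
    ContDiff ℝ (⊤ : ℕ∞) (sqrtLift m h) :=
  contDiff_infty.2 fun n => sqrtLift_contDiff_nat n m h hh

lemma sqrtLift_sq (h : ℝ → ℝ) (m : ℕ) {t : ℝ} (ht : 0 < t) :
    t ^ m * sqrtLift m h (t ^ 2) = h t := by
  have : 0 < t ^ 2 := by positivity
  simp only [sqrtLift, this, if_true, Real.sqrt_sq ht.le]
  field_simp

lemma bump_iter_bound (χ : ContDiffBump (0 : ℝ)) (n k : ℕ) :
    ∃ M : ℝ, 0 ≤ M ∧ ∀ y, ‖iteratedFDeriv ℝ k (fun y : ℝ => y ^ n * χ y) y‖ ≤ M := by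
  have hc : ContDiff ℝ (⊤ : ℕ∞) (fun y : ℝ => y ^ n * χ y) :=
    (contDiff_id.pow n).mul χ.contDiff
  have hs : HasCompactSupport (fun y : ℝ => y ^ n * χ y) := χ.hasCompactSupport.mul_left
  obtain ⟨M, hM⟩ := (hc.continuous_iteratedFDeriv (m := k) (by exact_mod_cast le_top)).bounded_above_of_compact_support
    (hs.iteratedFDeriv k)
  exact ⟨M, (norm_nonneg _).trans (hM 0), hM⟩

open Asymptotics Filter Topology in
/-- Borel's lemma in one variable. -/
lemma borel_lemma_s10 (c : ℕ → ℝ) : ∃ g : ℝ → ℝ, ContDiff ℝ (⊤ : ℕ∞) g ∧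
    ∀ N : ℕ, (fun x => g x - ∑ n ∈ Finset.range (N + 1), c n * x ^ n) =O[𝓝 0]
      (fun x : ℝ => x ^ N) := by
  let χ : ContDiffBump (0 : ℝ) := ⟨1, 2, by norm_num, by norm_num⟩
  choose M hM0 hM using bump_iter_bound χ
  let K : ℕ → ℝ := fun n => 2 + ∑ k ∈ Finset.range (n + 1), M n k
  have hK2 : ∀ n, 2 ≤ K n := fun n => by
    have := Finset.sum_nonneg (s := Finset.range (n+1)) fun k _ => hM0 n k
    simp only [K]; linarith
  have hKM : ∀ n k, k ≤ n → M n k ≤ K n := fun n k hk => by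
    have := Finset.single_le_sum (s := Finset.range (n+1)) (f := fun k => M n k) (fun k _ => hM0 n k)
      (Finset.mem_range.2 (Nat.lt_succ_of_le hk))
    simp only [K]; linarith
  let L : ℕ → ℝ := fun n => 2 + 2 ^ n * |c n| * K n
  have hL2 : ∀ n, 2 ≤ L n := fun n => by
    have : 0 ≤ 2 ^ n * |c n| * K n := by have := hK2 n; positivity
    simp only [L]; linarith
  have hL0 : ∀ n, 0 < L n := fun n => by linarith [hL2 n]
  have hcL : ∀ n, |c n| * (K n / L n) ≤ (1/2) ^ n := fun n => by
    have h2 : (0:ℝ) < 2 ^ n := by positivity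
    rw [← mul_div_assoc, div_le_iff₀ (hL0 n), one_div, inv_pow, ← div_eq_inv_mul, le_div_iff₀ h2]
    simp only [L]; linarith
  let u : ℕ → ℝ → ℝ := fun n x => c n * x ^ n * χ (L n * x)
  have hu : ∀ n, ContDiff ℝ (⊤ : ℕ∞) (u n) := fun n =>
    (contDiff_const.mul (contDiff_id.pow n)).mul (χ.contDiff.comp (contDiff_const.mul contDiff_id))
  have hgeo : Summable (fun n : ℕ => ((1:ℝ)/2) ^ n) := summable_geometric_two
  have hu_eq : ∀ n, u n = fun x => (c n / L n ^ n) *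
      ((fun x => (fun y : ℝ => y ^ n * χ y) (L n * x)) x) := fun n => by
    funext x
    have := (pow_pos (hL0 n) n).ne'
    simp only [u, mul_pow]
    field_simp
  have hder : ∀ k n, k < n → ∀ x, ‖iteratedFDeriv ℝ k (u n) x‖ ≤ (1/2) ^ n := by
    intro k n hkn x
    have hw : ContDiff ℝ k (fun y : ℝ => y ^ n * χ y) :=
      (contDiff_id.pow n).mul χ.contDiff
    rw [norm_iteratedFDeriv_eq_norm_iteratedDeriv, hu_eq, iteratedDeriv_const_mul_field,
      iteratedDeriv_comp_const_mul hw]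
    have h1 := hM n k (L n * x)
    rw [norm_iteratedFDeriv_eq_norm_iteratedDeriv] at h1
    have h2 : ‖c n / L n ^ n * (L n ^ k * iteratedDeriv k (fun y : ℝ => y ^ n * χ y) (L n * x))‖
        ≤ |c n| / L n ^ n * (L n ^ k * K n) := by
      rw [norm_mul, norm_mul, norm_div, norm_pow, norm_pow, Real.norm_eq_abs, Real.norm_eq_abs (L n),
        abs_of_pos (hL0 n)]
      have := hL0 n
      gcongr
      exact h1.trans (hKM n k hkn.le)
    refine h2.trans (le_trans ?_ (hcL n))
    obtain ⟨d, rfl⟩ := Nat.exists_eq_add_of_lt hkn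
    have hL := hL0 (k + d + 1)
    have h3 : (1:ℝ) ≤ L (k + d + 1) ^ d := one_le_pow₀ (by linarith [hL2 (k + d + 1)])
    have hK := hK2 (k + d + 1)
    have hc := abs_nonneg (c (k + d + 1))
    calc |c (k + d + 1)| / L (k + d + 1) ^ (k + d + 1) * (L (k + d + 1) ^ k * K (k + d + 1))
        = |c (k + d + 1)| * (K (k + d + 1) / L (k + d + 1)) / L (k + d + 1) ^ d := by
          field_simp
          ring
      _ ≤ _ := div_le_self (by positivity) h3
  have hbd : ∀ N n, N < n → ∀ x, |u n x| ≤ |x| ^ N * (1/2) ^ n := by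
    intro N n hn x
    by_cases hx : 2 ≤ |L n * x|
    · have : χ (L n * x) = 0 := χ.zero_of_le_dist (by simpa [χ] using hx)
      simp only [u, this, mul_zero, abs_zero]; positivity
    · push Not at hx
      rw [abs_mul, abs_of_pos (hL0 n)] at hx
      have hx1 : |x| ≤ K n / L n := by
        rw [le_div_iff₀ (hL0 n)]; linarith [hK2 n]
      have hx2 : |x| ≤ 1 := by nlinarith [hL2 n, abs_nonneg x]
      obtain ⟨d, rfl⟩ := Nat.exists_eq_add_of_lt hn
      have h1 : |χ (L (N + d + 1) * x)| ≤ 1 := by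
        rw [abs_of_nonneg χ.nonneg]; exact χ.le_one
      have h2 : |x| ^ d ≤ 1 := pow_le_one₀ (abs_nonneg x) hx2
      calc |u (N + d + 1) x| = |x| ^ N * (|c (N + d + 1)| * |x|) * (|x| ^ d) * |χ (L (N + d + 1) * x)| := by
            simp only [u, abs_mul, abs_pow]; ring
        _ ≤ |x| ^ N * (|c (N + d + 1)| * (K (N + d + 1) / L (N + d + 1))) * 1 * 1 := by
            have := hL0 (N + d + 1)
            have := hK2 (N + d + 1)
            gcongr
        _ ≤ _ := by
            rw [mul_one, mul_one]
            exact mul_le_mul_of_nonneg_left (hcL _) (by positivity)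
  have hsum : ∀ x, Summable (fun n => u n x) := fun x => by
    rw [← summable_nat_add_iff 1]
    refine Summable.of_norm_bounded ((summable_nat_add_iff 1).2 hgeo) fun n => ?_
    simpa using hbd 0 (n+1) (Nat.succ_pos n) x
  refine ⟨fun x => ∑' n, u n x, ?_, fun N => ?_⟩
  · refine contDiff_tsum_of_eventually (v := fun _ n => (1/2) ^ n) hu (fun _ _ => hgeo) fun k _ => ?_
    rw [Nat.cofinite_eq_atTop]
    filter_upwards [eventually_gt_atTop k] with n hn x
    exact hder k n hn x
  · refine IsBigO.of_bound (∑' n : ℕ, ((1:ℝ)/2) ^ (n + (N+1))) ?_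
    have hev : ∀ᶠ x in 𝓝 (0:ℝ), ∀ n ∈ Finset.range (N+1), χ (L n * x) = 1 := by
      rw [eventually_all_finset]
      intro n _
      have ht : Tendsto (fun x : ℝ => L n * x) (𝓝 0) (𝓝 0) := by
        have h := (tendsto_id (x := 𝓝 (0:ℝ))).const_mul (L n)
        rw [mul_zero] at h
        exact h
      exact ht.eventually χ.eventuallyEq_one
    filter_upwards [hev] with x hx
    have e1 : ∑ n ∈ Finset.range (N + 1), c n * x ^ n = ∑ n ∈ Finset.range (N + 1), u n x :=
      Finset.sum_congr rfl fun n hn => by simp [u, hx n hn]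
    have e2 := (hsum x).sum_add_tsum_nat_add (N + 1)
    rw [e1, ← e2, add_sub_cancel_left, norm_pow, Real.norm_eq_abs x, mul_comm]
    rw [← tsum_mul_left]
    refine tsum_of_norm_bounded (((summable_nat_add_iff (N+1)).2 hgeo).mul_left _).hasSum fun n => ?_
    exact hbd N (n + (N+1)) (by omega) x

open Asymptotics Filter Topology in
lemma smooth_decomp {f : ℝ → ℝ} (hf : ContDiff ℝ (⊤ : ℕ∞) f) :
    ∃ g₀ g₁ F : ℝ → ℝ, ContDiff ℝ (⊤ : ℕ∞) g₀ ∧ ContDiff ℝ (⊤ : ℕ∞) g₁ ∧ FlatAtZero F ∧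
      ∀ t, f t = g₀ (t ^ 2) + t * g₁ (t ^ 2) + F t := by
  let c : ℕ → ℝ := fun n => (n.factorial : ℝ)⁻¹ * iteratedDeriv n f 0
  obtain ⟨g₀, hg₀, h₀⟩ := borel_lemma_s10 fun n => c (2 * n)
  obtain ⟨g₁, hg₁, h₁⟩ := borel_lemma_s10 fun n => c (2 * n + 1)
  refine ⟨g₀, g₁, fun t => f t - (g₀ (t ^ 2) + t * g₁ (t ^ 2)), hg₀, hg₁, ⟨?_, ?_⟩,
    fun t => by ring⟩
  · exact hf.sub ((hg₀.comp (contDiff_id.pow 2)).add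
      (contDiff_id.mul (hg₁.comp (contDiff_id.pow 2))))
  · intro N
    have hsq : Tendsto (fun t : ℝ => t ^ 2) (𝓝 0) (𝓝 0) := by
      simpa using (continuous_pow 2 : Continuous fun t : ℝ => t ^ 2).tendsto 0
    have hT := (taylor_isLittleO_univ (f := f) (x₀ := 0) (n := 2 * N + 1)
      (contDiff_infty.1 hf _)).isBigO
    have hTe : ∀ t, taylorWithinEval f (2 * N + 1) Set.univ 0 t =
        ∑ n ∈ Finset.range (N + 1), c (2 * n) * (t ^ 2) ^ n +
        t * ∑ n ∈ Finset.range (N + 1), c (2 * n + 1) * (t ^ 2) ^ n := by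
      intro t
      rw [taylor_within_apply]
      have : ∀ M : ℕ, ∑ k ∈ Finset.range (2 * M), c k * t ^ k =
          ∑ n ∈ Finset.range M, c (2 * n) * (t ^ 2) ^ n +
          t * ∑ n ∈ Finset.range M, c (2 * n + 1) * (t ^ 2) ^ n := by
        intro M
        induction M with
        | zero => simp
        | succ M ih =>
          rw [show 2 * (M + 1) = 2 * M + 1 + 1 by ring, Finset.sum_range_succ,
            Finset.sum_range_succ, ih, Finset.sum_range_succ, Finset.sum_range_succ]
          ring
      rw [← this (N + 1)]
      refine Finset.sum_congr (by congr 1) fun k _ => ?_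
      simp only [iteratedDerivWithin_univ, sub_zero, smul_eq_mul, c]; ring
    simp only [sub_zero] at hT
    have p1 : (fun t : ℝ => t ^ (2 * N + 1)) =O[𝓝 0] fun t : ℝ => t ^ N :=
      (isLittleO_pow_pow (by omega)).isBigO
    have p2 : (fun t : ℝ => (t ^ 2) ^ N) =O[𝓝 0] fun t : ℝ => t ^ N := by
      rcases Nat.eq_zero_or_pos N with rfl | hN
      · simp only [pow_zero]
        exact isBigO_refl _ _
      · simp only [← pow_mul]
        exact (isLittleO_pow_pow (by omega)).isBigO
    have q0 := ((h₀ N).comp_tendsto hsq).trans p2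
    have q1 := ((h₁ N).comp_tendsto hsq).trans p2
    have hid : (fun t : ℝ => t) =O[𝓝 0] fun _ : ℝ => (1:ℝ) :=
      (continuous_id.tendsto (0:ℝ)).isBigO_one ℝ
    have q2 := hid.mul q1
    simp only [one_mul] at q2
    have := ((hT.trans p1).sub q0).sub q2
    refine this.congr_left fun t => ?_
    simp only [Function.comp, hTe]
    ring

lemma whitney_even_s10 {f : ℝ → ℝ} (hf : ContDiff ℝ (⊤ : ℕ∞) f) (he : ∀ t, 0 < t → f (-t) = f t) :
    ∃ g : ℝ → ℝ, ContDiff ℝ (⊤ : ℕ∞) g ∧ ∀ t, 0 < t → f t = g (t ^ 2) := by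
  obtain ⟨g₀, g₁, F, h0, h1, hF, h⟩ := smooth_decomp hf
  refine ⟨fun x => g₀ x + 1 / 2 * (sqrtLift 0 F x + sqrtLift 0 (fun y => F (-y)) x), 
    h0.add (contDiff_const.mul ((sqrtLift_contDiff hF 0).add (sqrtLift_contDiff hF.comp_neg 0))),
    fun t ht => ?_⟩
  have e1 := sqrtLift_sq F 0 ht
  have e2 := sqrtLift_sq (fun y => F (-y)) 0 ht
  have e3 := he t ht
  have e4 := h t
  have e5 := h (-t)
  rw [neg_sq] at e5
  simp only [pow_zero, one_mul] at e1 e2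
  simp only [e1, e2]
  linarith

lemma whitney_odd {f : ℝ → ℝ} (hf : ContDiff ℝ (⊤ : ℕ∞) f) (he : ∀ t, 0 < t → f (-t) = - f t) :
    ∃ g : ℝ → ℝ, ContDiff ℝ (⊤ : ℕ∞) g ∧ ∀ t, 0 < t → f t = t * g (t ^ 2) := by
  obtain ⟨g₀, g₁, F, h0, h1, hF, h⟩ := smooth_decomp hf
  refine ⟨fun x => g₁ x + 1 / 2 * (sqrtLift 1 F x - sqrtLift 1 (fun y => F (-y)) x), 
    h1.add (contDiff_const.mul ((sqrtLift_contDiff hF 1).sub (sqrtLift_contDiff hF.comp_neg 1))),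
    fun t ht => ?_⟩
  have e1 := sqrtLift_sq F 1 ht
  have e2 := sqrtLift_sq (fun y => F (-y)) 1 ht
  have e3 := he t ht
  have e4 := h t
  have e5 := h (-t)
  rw [neg_sq] at e5
  simp only [pow_one] at e1 e2
  rw [mul_add, mul_left_comm, mul_sub, e1, e2]
  linarith

theorem smooth_extension_iff_slice_and_trivial_module
    (a : ℕ) (ha : 0 < a)
    (G : ℂ → Matrix (Fin 3) (Fin 3) ℝ)
    (hsmooth : ∀ i j : Fin 3, ContDiffOn ℝ (⊤ : ℕ∞) (fun z => G z i j) {0}ᶜ)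
    (hsymm : ∀ z : ℂ, z ≠ 0 → (G z).IsSymm)
    (hequiv : ∀ (θ : ℝ) (z : ℂ), z ≠ 0 →
      G (Complex.exp ((a * θ : ℝ) * Complex.I) * z) =
        blockRot3 (a * θ) * G z * (blockRot3 (a * θ))ᵀ)
    (h11 : ∀ t : ℝ, 0 < t → G (t : ℂ) 0 0 = 1)
    (h22 : ∀ t : ℝ, 0 < t → G (t : ℂ) 1 1 = 1)
    (h12 : ∀ t : ℝ, 0 < t → G (t : ℂ) 0 1 = 0)
    (h13 : ∀ t : ℝ, 0 < t → G (t : ℂ) 0 2 = 0) :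
    (∃ Ge : ℂ → Matrix (Fin 3) (Fin 3) ℝ,
        (∀ i j : Fin 3, ContDiff ℝ (⊤ : ℕ∞) fun z => Ge z i j) ∧
        ∀ z : ℂ, z ≠ 0 → Ge z = G z) ↔
      ∃ φ ψ : ℝ → ℝ,
        ContDiff ℝ (⊤ : ℕ∞) φ ∧ ContDiff ℝ (⊤ : ℕ∞) ψ ∧
        ∀ t : ℝ, 0 < t →
          G (t : ℂ) 1 2 = t * φ (t ^ 2) ∧ G (t : ℂ) 2 2 = ψ (t ^ 2) := by
  have ha' : (a : ℝ) ≠ 0 := by positivity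
  have hrot : ∀ (s : ℝ) (z : ℂ), z ≠ 0 →
      G (Complex.exp ((s : ℝ) * Complex.I) * z) = blockRot3 s * G z * (blockRot3 s)ᵀ := by
    intro s z hz
    have := hequiv (s / a) z hz
    rwa [mul_div_cancel₀ _ ha'] at this
  have hform : ∀ t : ℝ, 0 < t → G (t : ℂ) =
      !![1, 0, 0; 0, 1, G (t : ℂ) 1 2; 0, G (t : ℂ) 1 2, G (t : ℂ) 2 2] := by
    intro t ht
    have hs := hsymm t (by exact_mod_cast ht.ne')
    have s10 := hs.apply 0 1
    have s20 := hs.apply 0 2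
    have s21 := hs.apply 1 2
    rw [h12 t ht] at s10
    rw [h13 t ht] at s20
    ext i j
    fin_cases i <;> fin_cases j <;> simp [h11 t ht, h22 t ht, h12 t ht, h13 t ht, s10, s20, s21]
  have hpol : ∀ (s t : ℝ), 0 < t → G (Complex.exp ((s : ℝ) * Complex.I) * t) =
      !![1, 0, -(Real.sin s * G (t : ℂ) 1 2); 0, 1, Real.cos s * G (t : ℂ) 1 2;
        -(Real.sin s * G (t : ℂ) 1 2), Real.cos s * G (t : ℂ) 1 2, G (t : ℂ) 2 2] := by
    intro s t ht
    rw [hrot s t (by exact_mod_cast ht.ne')]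
    generalize hq : G (t : ℂ) 1 2 = q
    generalize hr : G (t : ℂ) 2 2 = r
    rw [hform t ht, hq, hr]
    have hcs := Real.sin_sq_add_cos_sq s
    ext i j
    fin_cases i <;> fin_cases j <;>
      simp [blockRot3, Matrix.mul_apply, Fin.sum_univ_three] <;> nlinarith [hcs]
  constructor
  · rintro ⟨Ge, hGe, hext⟩
    have hneg : ∀ t : ℝ, 0 < t → G ((-t : ℝ) : ℂ) =
        !![1, 0, 0; 0, 1, - G (t : ℂ) 1 2; 0, - G (t : ℂ) 1 2, G (t : ℂ) 2 2] := by
      intro t ht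
      have := hpol Real.pi t ht
      simpa [Complex.exp_pi_mul_I] using this
    have hof : ContDiff ℝ (⊤ : ℕ∞) (fun t : ℝ => (t : ℂ)) := Complex.ofRealCLM.contDiff
    have hre : ∀ t : ℝ, t ≠ 0 → Ge (t : ℂ) = G (t : ℂ) := fun t ht => hext t (by exact_mod_cast ht)
    obtain ⟨φ, hφ, hφ'⟩ := whitney_odd (f := fun t : ℝ => Ge (t : ℂ) 1 2) ((hGe 1 2).comp hof)
      (fun t ht => by
        rw [hre _ (neg_ne_zero.2 ht.ne'), hre _ ht.ne', hneg t ht]; simp)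
    obtain ⟨ψ, hψ, hψ'⟩ := whitney_even_s10 (f := fun t : ℝ => Ge (t : ℂ) 2 2) ((hGe 2 2).comp hof)
      (fun t ht => by
        rw [hre _ (neg_ne_zero.2 ht.ne'), hre _ ht.ne', hneg t ht]; simp)
    refine ⟨φ, ψ, hφ, hψ, fun t ht => ⟨?_, ?_⟩⟩
    · rw [← hφ' t ht, hre t ht.ne']
    · rw [← hψ' t ht, hre t ht.ne']
  · rintro ⟨φ, ψ, hφ, hψ, h⟩
    have hx : ContDiff ℝ (⊤ : ℕ∞) (fun z : ℂ => z.re) := Complex.reCLM.contDiff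
    have hy : ContDiff ℝ (⊤ : ℕ∞) (fun z : ℂ => z.im) := Complex.imCLM.contDiff
    have hn : ContDiff ℝ (⊤ : ℕ∞) (fun z : ℂ => z.re ^ 2 + z.im ^ 2) := (hx.pow 2).add (hy.pow 2)
    have hP : ContDiff ℝ (⊤ : ℕ∞) (fun z : ℂ => φ (z.re ^ 2 + z.im ^ 2)) := hφ.comp hn
    have hQ : ContDiff ℝ (⊤ : ℕ∞) (fun z : ℂ => ψ (z.re ^ 2 + z.im ^ 2)) := hψ.comp hn
    have hA := (hy.mul hP).neg
    have hB := hx.mul hP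
    refine ⟨fun z => !![1, 0, -(z.im * φ (z.re ^ 2 + z.im ^ 2));
      0, 1, z.re * φ (z.re ^ 2 + z.im ^ 2);
      -(z.im * φ (z.re ^ 2 + z.im ^ 2)), z.re * φ (z.re ^ 2 + z.im ^ 2),
      ψ (z.re ^ 2 + z.im ^ 2)], ?_, ?_⟩
    · intro i j
      fin_cases i <;> fin_cases j <;> first
        | exact contDiff_const
        | exact hA
        | exact hB
        | exact hQ
    · intro z hz
      have ht : 0 < ‖z‖ := norm_pos_iff.2 hz
      have e := hpol z.arg ‖z‖ ht
      rw [mul_comm, Complex.norm_mul_exp_arg_mul_I, (h _ ht).1, (h _ ht).2] at e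
      have hnn : ‖z‖ ^ 2 = z.re ^ 2 + z.im ^ 2 := by
        rw [Complex.sq_norm, Complex.normSq_apply]; ring
      have hc : ‖z‖ * Real.cos z.arg = z.re := Complex.norm_mul_cos_arg z
      have hs : ‖z‖ * Real.sin z.arg = z.im := Complex.norm_mul_sin_arg z
      beta_reduce
      rw [e, ← hnn, ← mul_assoc, ← mul_assoc, mul_comm (Real.sin _), mul_comm (Real.cos _), hc, hs]
end
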